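/- arXiv:2006.12481 — 15 statements merged into one kernel-verified Lean document; each statement's English description precedes it below -/
import Mathlib

section
/- Let C = {c_1 < c_2 < c_3 < ...} be an infinite set of natural numbers. If limsup_{i → ∞} (c_{i+1} − c_i) = ∞ (i.e., C has arbitrarily large gaps between consecutive elements), then C arises as a minimal additive complement in the integers. -/
open Pointwise

/-- `C` is a minimal additive complement to `W` in `ℤ`:
`C + W = ℤ` and no proper subset of `C` is an additive complement to `W`. -/
def MinAddComp (C W : Set ℤ) : Prop :=
  C + W = Set.univ ∧ ∀ C' : Set ℤ, C' ⊂ C → C' + W ≠ Set.univ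

/-- The integer `n` lies in `{c 0, c 1, …} + W`. -/
def CoveredBy (c : ℕ → ℕ) (W : Finset ℤ) (n : ℤ) : Prop :=
  ∃ i, n - (c i : ℤ) ∈ W

/-- A finite set `W` together with a bound `B` such that every integer of `[0, B]` is covered. -/
def CoversUpTo (c : ℕ → ℕ) (σ : Finset ℤ × ℤ) : Prop :=
  -1 ≤ σ.2 ∧ ∀ n, 0 ≤ n → n ≤ σ.2 → CoveredBy c σ.1 n

/-- `σ'` enlarges `σ` without adding any representation of an integer of `[0, σ.2]`. -/
def Extends (c : ℕ → ℕ) (σ σ' : Finset ℤ × ℤ) : Prop :=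
  σ.1 ⊆ σ'.1 ∧ σ.2 ≤ σ'.2 ∧
    ∀ n, 0 ≤ n → n ≤ σ.2 → ∀ j, n - (c j : ℤ) ∈ σ'.1 → n - (c j : ℤ) ∈ σ.1

/-- `t` is represented by `c s`, and by no other element, as an element of `{c 0, c 1, …} + W`. -/
def IsPrivate (c : ℕ → ℕ) (W : Finset ℤ) (s : ℕ) (t : ℤ) : Prop :=
  t - (c s : ℤ) ∈ W ∧ ∀ j, t - (c j : ℤ) ∈ W → j = s

theorem Extends.refl (c : ℕ → ℕ) (σ : Finset ℤ × ℤ) : Extends c σ σ :=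
  ⟨subset_rfl, le_rfl, fun _ _ _ _ h => h⟩

theorem Extends.trans {c : ℕ → ℕ} {σ τ ρ : Finset ℤ × ℤ} (h : Extends c σ τ)
    (h' : Extends c τ ρ) : Extends c σ ρ :=
  ⟨h.1.trans h'.1, h.2.1.trans h'.2.1, fun n h0 hn j hj =>
    h.2.2 n h0 hn j (h'.2.2 n h0 (hn.trans h.2.1) j hj)⟩

theorem CoveredBy.mono {c : ℕ → ℕ} {V W : Finset ℤ} (h : V ⊆ W) {n : ℤ}
    (hn : CoveredBy c V n) : CoveredBy c W n :=
  hn.imp fun _ hi => h hi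

theorem extends_insert {c : ℕ → ℕ} {σ : Finset ℤ × ℤ} {w B : ℤ} (hB : σ.2 ≤ B)
    (hw : ∀ j, w + (c j : ℤ) < 0 ∨ σ.2 < w + (c j : ℤ)) :
    Extends c σ (insert w σ.1, B) := by
  refine ⟨Finset.subset_insert _ _, hB, fun n h0 hn j hj => ?_⟩
  rcases Finset.mem_insert.1 hj with h | h
  · rcases hw j with h' | h' <;> omega
  · exact h

theorem exists_extends_succ {c : ℕ → ℕ} (hmono : StrictMono c) {σ : Finset ℤ × ℤ}
    (hσ : CoversUpTo c σ) : ∃ σ', CoversUpTo c σ' ∧ Extends c σ σ' ∧ σ'.2 = σ.2 + 1 := by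
  refine ⟨(insert (σ.2 + 1 - (c 0 : ℤ)) σ.1, σ.2 + 1), ⟨?_, fun n h0 hn => ?_⟩,
    extends_insert (by omega) fun j => ?_, rfl⟩
  · have := hσ.1
    dsimp only
    omega
  · rcases (show n ≤ σ.2 + 1 from hn).lt_or_eq with h | h
    · exact (hσ.2 n h0 (by omega)).mono (Finset.subset_insert _ _)
    · exact ⟨0, by simp [h]⟩
  · have : c 0 ≤ c j := hmono.monotone (Nat.zero_le j)
    omega

theorem exists_extends_add {c : ℕ → ℕ} (hmono : StrictMono c) {σ : Finset ℤ × ℤ}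
    (hσ : CoversUpTo c σ) (N : ℕ) :
    ∃ σ', CoversUpTo c σ' ∧ Extends c σ σ' ∧ σ'.2 = σ.2 + N := by
  induction N with
  | zero => exact ⟨σ, hσ, Extends.refl c σ, by simp⟩
  | succ N ih =>
    obtain ⟨τ, hτ, hστ, hN⟩ := ih
    obtain ⟨ρ, hρ, hτρ, h1⟩ := exists_extends_succ hmono hτ
    exact ⟨ρ, hρ, hστ.trans hτρ, by push_cast; omega⟩

theorem exists_not_coveredBy {c : ℕ → ℕ} (hmono : StrictMono c)
    (hgap : ∀ N : ℕ, ∀ i₀ : ℕ, ∃ i ≥ i₀, N ≤ c (i + 1) - c i) (W : Finset ℤ) (b : ℕ) :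
    ∃ n : ℕ, b < n ∧ ¬ CoveredBy c W n := by
  obtain ⟨K, hK⟩ : ∃ K : ℕ, ∀ w ∈ W, w.natAbs ≤ K :=
    ⟨W.sup Int.natAbs, fun w hw => Finset.le_sup (f := Int.natAbs) hw⟩
  obtain ⟨i, hi, hgi⟩ := hgap (2 * K + 2) b
  have hci : i ≤ c i := hmono.le_apply
  refine ⟨c i + K + 1, by omega, ?_⟩
  rintro ⟨j, hj⟩
  have hw := hK _ hj
  rcases Nat.lt_or_ge i j with h | h
  · have : c (i + 1) ≤ c j := hmono.monotone h
    omega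
  · have : c j ≤ c i := hmono.monotone h
    omega

theorem exists_extends_isPrivate {c : ℕ → ℕ} (hmono : StrictMono c)
    (hgap : ∀ N : ℕ, ∀ i₀ : ℕ, ∃ i ≥ i₀, N ≤ c (i + 1) - c i) {σ : Finset ℤ × ℤ}
    (hσ : CoversUpTo c σ) (s : ℕ) :
    ∃ σ', CoversUpTo c σ' ∧ Extends c σ σ' ∧ σ.2 < σ'.2 ∧
      ∃ t, 0 ≤ t ∧ t ≤ σ'.2 ∧ IsPrivate c σ'.1 s t := by
  classical
  obtain ⟨τ, hτ, hστ, hτs⟩ := exists_extends_add hmono hσ (c s + 1)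
  push_cast at hτs
  have hσ1 := hσ.1
  have hex : ∃ n : ℕ, τ.2 < n ∧ ¬ CoveredBy c τ.1 n := by
    obtain ⟨n, hn, h⟩ := exists_not_coveredBy hmono hgap τ.1 τ.2.toNat
    exact ⟨n, by omega, h⟩
  obtain ⟨hn, hnc⟩ := Nat.find_spec hex
  have hmin : ∀ m : ℕ, m < Nat.find hex → CoveredBy c τ.1 m := by
    intro m hm
    by_contra h
    by_cases h' : τ.2 < m
    · exact Nat.find_min hex hm ⟨h', h⟩
    · exact h (hτ.2 m (by omega) (by omega))
  generalize Nat.find hex = n at hn hnc hmin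
  refine ⟨(insert ((n : ℤ) - c s) τ.1, n), ⟨by dsimp only; omega, fun m h0 hm => ?_⟩, ?_,
    by dsimp only; omega, n, by omega, le_rfl, Finset.mem_insert_self _ _, fun j hj => ?_⟩
  · lift m to ℕ using h0
    rcases (show (m : ℤ) ≤ n from hm).lt_or_eq with h | h
    · exact (hmin m (by omega)).mono (Finset.subset_insert _ _)
    · exact ⟨s, by simp [h]⟩
  · refine ⟨hστ.1.trans (Finset.subset_insert _ _), by dsimp only; omega, fun m h0 hm j hj => ?_⟩
    rcases Finset.mem_insert.1 hj with h | h
    · omega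
    · exact hστ.2.2 m h0 hm j h
  · rcases Finset.mem_insert.1 hj with h | h
    · exact hmono.injective (by omega)
    · exact absurd ⟨j, h⟩ hnc

theorem exists_extends_coveredBy_neg {c : ℕ → ℕ} (hmono : StrictMono c)
    (hgap : ∀ N : ℕ, ∀ i₀ : ℕ, ∃ i ≥ i₀, N ≤ c (i + 1) - c i) {σ : Finset ℤ × ℤ}
    (hσ : CoversUpTo c σ) {m : ℤ} (hm : m < 0) :
    ∃ σ', CoversUpTo c σ' ∧ Extends c σ σ' ∧ σ'.2 = σ.2 ∧ CoveredBy c σ'.1 m := by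
  obtain ⟨i, -, hi⟩ := hgap (σ.2 - m + 1).toNat 0
  have hσ1 := hσ.1
  refine ⟨(insert (m - (c i : ℤ)) σ.1, σ.2), ⟨hσ1, fun n h0 hn =>
    (hσ.2 n h0 hn).mono (Finset.subset_insert _ _)⟩, extends_insert le_rfl fun j => ?_, rfl,
    i, Finset.mem_insert_self _ _⟩
  rcases Nat.lt_or_ge i j with h | h
  · have : c (i + 1) ≤ c j := hmono.monotone h
    omega
  · have : c j ≤ c i := hmono.monotone h
    omega

/-- If `C = {c 0 < c 1 < ⋯}` is an infinite set of natural numbers with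
`limsup (c (i+1) - c i) = ∞`, then `C` arises as a minimal additive complement in `ℤ`. -/
theorem stmt0 (c : ℕ → ℕ) (hmono : StrictMono c)
    (hgap : ∀ N : ℕ, ∀ i₀ : ℕ, ∃ i ≥ i₀, N ≤ c (i + 1) - c i) :
    ∃ W : Set ℤ, MinAddComp (Set.range fun i => (c i : ℤ)) W := by
  have hstep : ∀ (k : ℕ) (σ : {σ // CoversUpTo c σ}), ∃ σ' : {σ // CoversUpTo c σ},
      Extends c σ.1 σ'.1 ∧ σ.1.2 < σ'.1.2 ∧ CoveredBy c σ'.1.1 (-(k : ℤ) - 1) ∧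
        ∃ t, 0 ≤ t ∧ t ≤ σ'.1.2 ∧ IsPrivate c σ'.1.1 k t := by
    rintro k ⟨σ, hσ⟩
    obtain ⟨τ, hτ, hστ, hB, hcov⟩ :=
      exists_extends_coveredBy_neg hmono hgap hσ (m := -(k : ℤ) - 1) (by omega)
    obtain ⟨ρ, hρ, hτρ, hlt, hpriv⟩ := exists_extends_isPrivate hmono hgap hτ k
    exact ⟨⟨ρ, hρ⟩, hστ.trans hτρ, hB ▸ hlt, hcov.mono hτρ.1, hpriv⟩
  choose next hext hlt hneg hpriv using hstep
  let σ : ℕ → {σ // CoversUpTo c σ} := fun n =>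
    Nat.rec ⟨(∅, -1), le_rfl, fun n h0 hn => absurd (h0.trans hn) (by norm_num)⟩ next n
  have hσ : ∀ k l, k ≤ l → Extends c (σ k).1 (σ l).1 := by
    intro k l hkl
    induction l, hkl using Nat.le_induction with
    | base => exact Extends.refl c _
    | succ l _ ih => exact ih.trans (hext l (σ l))
  have hB : ∀ k : ℕ, (k : ℤ) - 1 ≤ (σ k).1.2 := by
    intro k
    induction k with
    | zero => exact le_rfl
    | succ k ih =>
      have : (σ k).1.2 < (σ (k + 1)).1.2 := hlt k (σ k)
      push_cast
      omega
  refine ⟨⋃ k, ((σ k).1.1 : Set ℤ), Set.eq_univ_of_forall fun n => ?_, fun C' hC' huniv => ?_⟩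
  · obtain ⟨k, i, hi⟩ : ∃ k, CoveredBy c (σ k).1.1 n := by
      rcases lt_or_ge n 0 with h | h
      · refine ⟨(-n - 1).toNat + 1, ?_⟩
        have := hneg (-n - 1).toNat (σ (-n - 1).toNat)
        rwa [show (-((-n - 1).toNat : ℤ) - 1) = n by omega] at this
      · exact ⟨n.toNat + 1, (σ (n.toNat + 1)).2.2 n h (by
          have := hB (n.toNat + 1)
          push_cast at this
          omega)⟩
    exact Set.mem_add.2 ⟨c i, ⟨i, rfl⟩, n - c i, Set.mem_iUnion.2 ⟨k, hi⟩, by ring⟩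
  · obtain ⟨-, ⟨s, rfl⟩, hs⟩ := Set.exists_of_ssubset hC'
    obtain ⟨t, ht0, ht, -, huniq⟩ := hpriv s (σ s)
    obtain ⟨x, hx, w, hw, hxw⟩ := Set.mem_add.1 (huniv ▸ Set.mem_univ t : t ∈ C' + _)
    obtain ⟨j, rfl⟩ := hC'.1 hx
    obtain ⟨l, hl⟩ := Set.mem_iUnion.1 hw
    have hwt : w = t - (c j : ℤ) := by
      dsimp only at hxw
      omega
    have hmem : t - (c j : ℤ) ∈ (σ (max l (s + 1))).1.1 := (hσ l _ (le_max_left _ _)).1 (hwt ▸ hl)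
    have hj := huniq j ((hσ (s + 1) _ (le_max_right _ _)).2.2 t ht0 ht j hmem)
    exact hs (hj ▸ hx)
end

section
/- Let C = {c_1 < c_2 < c_3 < ...} be an infinite set of natural numbers and let the complement ℕ \ C = {c̄_1 < c̄_2 < c̄_3 < ...}. If lim_{i → ∞} (c̄_{i+1} − c̄_i) = ∞, then C does not arise as a minimal additive complement in the integers. -/
open Pointwise

/-- If `C` is a minimal additive complement to `W`, every `x ∈ C` is the only element of `C`
representing some integer `n`. -/
lemma MinAddComp.exists_unique_representation {C W : Set ℤ} (h : MinAddComp C W) {x : ℤ}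
    (hx : x ∈ C) : ∃ n : ℤ, n - x ∈ W ∧ ∀ w ∈ W, n - w ∈ C → n - w = x := by
  have hne := h.2 (C \ {x}) ⟨Set.sdiff_subset, fun hsub => (hsub hx).2 rfl⟩
  obtain ⟨n, hn⟩ := (Set.ne_univ_iff_exists_notMem _).1 hne
  have huniq : ∀ w ∈ W, n - w ∈ C → n - w = x := by
    intro w hw hnw
    by_contra hnx
    exact hn (Set.mem_add.2 ⟨n - w, ⟨hnw, hnx⟩, w, hw, by ring⟩)
  obtain ⟨y, hy, w, hw, hyw⟩ := Set.mem_add.1 (h.1 ▸ Set.mem_univ n)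
  have hyx := huniq w hw (by rwa [← hyw, add_sub_cancel_right])
  refine ⟨n, ?_, huniq⟩
  rwa [← hyx, sub_sub_cancel]

/-- If consecutive gaps of a strictly increasing sequence tend to infinity, then far enough out any
two distinct terms are far apart. -/
lemma StrictMono.exists_forall_lt_sub_of_tendsto_gap {u : ℕ → ℕ} (hu : StrictMono u)
    (hlim : Filter.Tendsto (fun i => u (i + 1) - u i) Filter.atTop Filter.atTop) (d : ℕ) :
    ∃ M : ℕ, ∀ i j : ℕ, M ≤ u i → u i < u j → d < u j - u i := by
  obtain ⟨N, hN⟩ := Filter.eventually_atTop.1 (hlim.eventually_gt_atTop d)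
  refine ⟨u N, fun i j hi hij => ?_⟩
  have hgap := hN i (hu.le_iff_le.1 hi)
  have hmono := hu.monotone (Nat.succ_le_of_lt (hu.lt_iff_lt.1 hij))
  simp only [Nat.succ_eq_add_one] at hmono
  omega

/-- If `C = {c 0 < c 1 < ⋯}` is an infinite set of natural numbers whose complement in `ℕ`
is `{cbar 0 < cbar 1 < ⋯}`, and `lim (cbar (i+1) - cbar i) = ∞`, then `C` does not arise
as a minimal additive complement in `ℤ`. -/
theorem stmt1 (c cbar : ℕ → ℕ) (hc : StrictMono c) (hcbar : StrictMono cbar)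
    (hcompl : Set.range cbar = {n : ℕ | n ∉ Set.range c})
    (hlim : Filter.Tendsto (fun i => cbar (i + 1) - cbar i) Filter.atTop Filter.atTop) :
    ¬ ∃ W : Set ℤ, MinAddComp (Set.range fun i => (c i : ℤ)) W := by
  rintro ⟨W, hW⟩
  obtain ⟨m, hmW, hm⟩ := hW.exists_unique_representation (x := (c 0 : ℤ)) ⟨0, rfl⟩
  obtain ⟨n, hnW, hn⟩ := hW.exists_unique_representation (x := (c 1 : ℤ)) ⟨1, rfl⟩
  have h01 : c 0 < c 1 := hc Nat.zero_lt_one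
  have hmn : m ≠ n := by
    rintro rfl
    have := hm _ hnW ⟨1, by simp⟩
    omega
  obtain ⟨M, hM⟩ := hcbar.exists_forall_lt_sub_of_tendsto_gap hlim (m - n).natAbs
  obtain ⟨w, hw, hwle⟩ : ∃ w ∈ W, w ≤ -((M : ℤ) + c 0 + c 1 + 1 + |m| + |n|) := by
    obtain ⟨y, ⟨k, rfl⟩, w, hw, hkw⟩ := Set.mem_add.1
      (hW.1 ▸ Set.mem_univ (-((M : ℤ) + c 0 + c 1 + 1 + |m| + |n|)))
    dsimp only at hkw
    exact ⟨w, hw, by omega⟩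
  have hmem : ∀ (z : ℤ) (k : ℕ), (∀ w ∈ W, z - w ∈ Set.range (fun i => (c i : ℤ)) →
      z - w = c k) → (c k : ℤ) < z - w → ∃ i, (cbar i : ℤ) = z - w := by
    intro z k hz hlt
    have hnot : (z - w).toNat ∈ {n : ℕ | n ∉ Set.range c} := by
      rintro ⟨l, hl⟩
      have := hz w hw ⟨l, by dsimp only; omega⟩
      omega
    rw [← hcompl] at hnot
    obtain ⟨i, hi⟩ := hnot
    exact ⟨i, by omega⟩
  have hm_abs := neg_abs_le m
  have hn_abs := neg_abs_le n
  have hm_nonneg := abs_nonneg m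
  have hn_nonneg := abs_nonneg n
  obtain ⟨i, hi⟩ := hmem m 0 hm (by linarith)
  obtain ⟨j, hj⟩ := hmem n 1 hn (by linarith)
  have hij := hM i j
  have hji := hM j i
  omega
end

section
/- Every lacunary sequence belongs to a co-minimal pair in the integers. That is, if X = {x_1 < x_2 < x_3 < ...} is a set of positive integers such that x_{n+1}/x_n ≥ λ for some real constant λ > 1 and all n, then there exists W ⊆ ℤ such that X is a minimal additive complement to W and W is a minimal additive complement to X. -/
open Pointwise

/-- Read `(p, i)` as the element `p - x i` of a set `W`. In a uniquely represented set of pairs,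
each such `p` has exactly one representation in `W + range x`, namely `(p - x i) + x i`. -/
def UniquelyRepresented (x : ℕ → ℤ) (T : Set (ℤ × ℕ)) : Prop :=
  ∀ a ∈ T, ∀ b ∈ T, ∀ m, b.1 - x b.2 + x m = a.1 → b = a

theorem UniquelyRepresented.insert {x : ℕ → ℤ} {T : Set (ℤ × ℕ)} {p : ℤ} {i : ℕ}
    (hT : UniquelyRepresented x T)
    (hp : ∀ b ∈ T, ∀ m, b.1 - x b.2 + x m ≠ p) (hw : ∀ a ∈ T, ∀ m, p - x i + x m ≠ a.1) :
    UniquelyRepresented x (insert (p, i) T) := by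
  rintro a (rfl | ha) b (rfl | hb) m h
  · rfl
  · exact (hp b hb m h).elim
  · exact (hw a ha m h).elim
  · exact hT a ha b hb m h

theorem UniquelyRepresented.minAddComp {x : ℕ → ℤ} {T : Set (ℤ × ℕ)}
    (hT : UniquelyRepresented x T)
    (hcover : ∀ t, ∃ b ∈ T, ∃ m, b.1 - x b.2 + x m = t) (hindex : ∀ k, ∃ p, (p, k) ∈ T) :
    MinAddComp (Set.range x) ((fun a : ℤ × ℕ => a.1 - x a.2) '' T) ∧
      MinAddComp ((fun a : ℤ × ℕ => a.1 - x a.2) '' T) (Set.range x) := by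
  have hsum : ((fun a : ℤ × ℕ => a.1 - x a.2) '' T) + Set.range x = Set.univ := by
    refine Set.eq_univ_of_forall fun t => ?_
    obtain ⟨b, hb, m, h⟩ := hcover t
    exact ⟨_, ⟨b, hb, rfl⟩, _, ⟨m, rfl⟩, h⟩
  refine ⟨⟨add_comm (Set.range x) _ ▸ hsum, ?_⟩, hsum, ?_⟩
  · intro C hC h
    obtain ⟨hsub, y, ⟨k, rfl⟩, hk⟩ := Set.ssubset_iff_exists.1 hC
    obtain ⟨p, hp⟩ := hindex k
    obtain ⟨c, hc, _, ⟨b, hb, rfl⟩, hcb⟩ := h.symm ▸ Set.mem_univ p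
    obtain ⟨m, rfl⟩ := hsub hc
    obtain rfl := hT _ hp b hb m ((add_comm _ _).trans hcb)
    have : x m = x k := by simp at hcb; linarith
    exact hk (this ▸ hc)
  · intro C hC h
    obtain ⟨hsub, _, ⟨a, ha, rfl⟩, hk⟩ := Set.ssubset_iff_exists.1 hC
    obtain ⟨c, hc, _, ⟨m, rfl⟩, hcm⟩ := h.symm ▸ Set.mem_univ a.1
    obtain ⟨b, hb, rfl⟩ := hsub hc
    obtain rfl := hT a ha b hb m hcm
    exact hk hc

theorem StrictMono.tendsto_atTop_int {x : ℕ → ℤ} (hmono : StrictMono x) :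
    Filter.Tendsto x Filter.atTop Filter.atTop := by
  have hle : ∀ n : ℕ, x 0 + n ≤ x n := by
    intro n
    induction n with
    | zero => simp
    | succ n ih =>
      have := hmono n.lt_add_one
      push_cast
      omega
  exact Filter.tendsto_atTop_mono hle
    (Filter.tendsto_atTop_add_const_left _ _ tendsto_natCast_atTop_atTop)

theorem eventually_sub_ne_of_lacunary {x : ℕ → ℤ} (hmono : StrictMono x)
    {l : ℝ} (hl : 1 < l) (hlac : ∀ n, l * (x n : ℝ) ≤ (x (n + 1) : ℝ)) {d : ℤ} (hd : d ≠ 0) :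
    ∀ᶠ n in Filter.atTop, ∀ m, x m - x n ≠ d := by
  have hlt : ∀ {i j}, i < j → l * (x i : ℝ) ≤ x j := fun {i j} hij =>
    (hlac i).trans (by exact_mod_cast hmono.monotone hij)
  have htop : Filter.Tendsto (fun n => (l - 1) * (x n : ℝ)) Filter.atTop Filter.atTop :=
    (tendsto_intCast_atTop_atTop.comp
      hmono.tendsto_atTop_int).const_mul_atTop (sub_pos.2 hl)
  filter_upwards [htop.eventually_gt_atTop (l * |(d : ℝ)|)] with n hn m hm
  have hm' : (x m : ℝ) = x n + d := by rw [← hm]; push_cast; ring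
  rcases lt_trichotomy m n with h | rfl | h
  · have := hlt h
    nlinarith [neg_le_abs (d : ℝ)]
  · exact hd (by rw [← hm, sub_self])
  · have := hlt h
    nlinarith [le_abs_self (d : ℝ), abs_nonneg (d : ℝ)]

theorem eventually_avoids {x : ℕ → ℤ}
    (hdiff : ∀ d : ℤ, d ≠ 0 → ∀ᶠ n in Filter.atTop, ∀ m, x m - x n ≠ d)
    {S : Finset (ℤ × ℕ)} {s : ℤ} (hs : ∀ a ∈ S, a.1 ≠ s) :
    ∀ᶠ n in Filter.atTop, ∀ a ∈ S, ∀ m, s - x n + x m ≠ a.1 := by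
  refine (Filter.eventually_all_finset S).2 fun a ha => ?_
  filter_upwards [hdiff (a.1 - s) (sub_ne_zero.2 (hs a ha))] with n hn m h
  exact hn m (by rw [← h]; ring)

theorem exists_extension_covering {x : ℕ → ℤ}
    (hdiff : ∀ d : ℤ, d ≠ 0 → ∀ᶠ n in Filter.atTop, ∀ m, x m - x n ≠ d)
    {S : Finset (ℤ × ℕ)} (hS : UniquelyRepresented x S) (t : ℤ) :
    ∃ S' : Finset (ℤ × ℕ), UniquelyRepresented x S' ∧ S ⊆ S' ∧
      ∃ b ∈ S', ∃ m, b.1 - x b.2 + x m = t := by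
  by_cases ht : ∃ b ∈ S, ∃ m, b.1 - x b.2 + x m = t
  · exact ⟨S, hS, subset_rfl, ht⟩
  push Not at ht
  have htS : ∀ a ∈ S, a.1 ≠ t := fun a ha h => ht a ha a.2 (by rw [sub_add_cancel, h])
  obtain ⟨n, hn⟩ := (eventually_avoids hdiff htS).exists
  refine ⟨insert (t, n) S, ?_, Finset.subset_insert _ _, (t, n), Finset.mem_insert_self _ _, n,
    sub_add_cancel _ _⟩
  rw [Finset.coe_insert]
  exact hS.insert ht hn

theorem exists_extension_index {x : ℕ → ℤ} (hpos : ∀ n, 0 < x n)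
    (htop : Filter.Tendsto x Filter.atTop Filter.atTop)
    (hdiff : ∀ d : ℤ, d ≠ 0 → ∀ᶠ n in Filter.atTop, ∀ m, x m - x n ≠ d)
    {S : Finset (ℤ × ℕ)} (hS : UniquelyRepresented x S) (k : ℕ) :
    ∃ S' : Finset (ℤ × ℕ), UniquelyRepresented x S' ∧ S ⊆ S' ∧ ∃ p, (p, k) ∈ S' := by
  obtain ⟨s, hs⟩ := (S.image Prod.fst).exists_notMem
  have hsS : ∀ a ∈ S, a.1 ≠ s := fun a ha h => hs (h ▸ Finset.mem_image_of_mem _ ha)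
  have hlarge : ∀ᶠ n in Filter.atTop, ∀ b ∈ S, s + x k - (b.1 - x b.2) ≤ x n :=
    (Filter.eventually_all_finset S).2 fun b _ => htop.eventually_ge_atTop _
  obtain ⟨n, hn, hn'⟩ := ((eventually_avoids hdiff hsS).and hlarge).exists
  refine ⟨insert (s - x n + x k, k) S, ?_, Finset.subset_insert _ _, _,
    Finset.mem_insert_self _ _⟩
  rw [Finset.coe_insert]
  refine hS.insert (fun b hb m h => ?_) (by simpa using hn)
  linarith [hn' b hb, hpos m]

/-- Every lacunary sequence `X = {x 0 < x 1 < ⋯}` of positive integers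
(with `x (n+1) / x n ≥ l` for some real `l > 1`) belongs to a co-minimal pair in `ℤ`. -/
theorem stmt2 (x : ℕ → ℤ) (hpos : ∀ n, 0 < x n) (hmono : StrictMono x)
    (hlac : ∃ l : ℝ, 1 < l ∧ ∀ n, l * (x n : ℝ) ≤ (x (n + 1) : ℝ)) :
    ∃ W : Set ℤ, MinAddComp (Set.range x) W ∧ MinAddComp W (Set.range x) := by
  obtain ⟨l, hl, hlac⟩ := hlac
  have hdiff : ∀ d : ℤ, d ≠ 0 → ∀ᶠ n in Filter.atTop, ∀ m, x m - x n ≠ d :=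
    fun _ => eventually_sub_ne_of_lacunary hmono hl hlac
  let P := {S : Finset (ℤ × ℕ) // UniquelyRepresented x S}
  let D : ℤ ⊕ ℕ → Order.Cofinal P := Sum.elim
    (fun t => ⟨{S | ∃ b ∈ S.1, ∃ m, b.1 - x b.2 + x m = t}, fun S =>
      let ⟨S', h, hsub, hmem⟩ := exists_extension_covering hdiff S.2 t
      ⟨⟨S', h⟩, hmem, hsub⟩⟩)
    (fun k => ⟨{S | ∃ p, (p, k) ∈ S.1}, fun S =>
      let ⟨S', h, hsub, hmem⟩ :=
        exists_extension_index hpos hmono.tendsto_atTop_int hdiff S.2 k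
      ⟨⟨S', h⟩, hmem, hsub⟩⟩)
  let I := Order.idealOfCofinals (⟨∅, by simp [UniquelyRepresented]⟩ : P) D
  have hmeets : ∀ i, ∃ S : P, S ∈ D i ∧ S ∈ I := Order.cofinal_meets_idealOfCofinals _ D
  have hT : UniquelyRepresented x {a | ∃ S ∈ I, a ∈ S.1} := by
    rintro a ⟨S, hSI, ha⟩ b ⟨S', hSI', hb⟩
    obtain ⟨U, -, hU, hU'⟩ := I.directed S hSI S' hSI'
    exact U.2 a (hU ha) b (hU' hb)
  refine ⟨_, hT.minAddComp (fun t => ?_) fun k => ?_⟩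
  · obtain ⟨S, ⟨b, hb, h⟩, hSI⟩ := hmeets (.inl t)
    exact ⟨b, ⟨S, hSI, hb⟩, h⟩
  · obtain ⟨S, ⟨p, hp⟩, hSI⟩ := hmeets (.inr k)
    exact ⟨p, S, hSI, hp⟩
end

section
/- Let C = {c_1 < c_2 < c_3 < ...} be an infinite set of natural numbers. If limsup_{i → ∞} (c_{i+1} − c_i) = ∞, then C belongs to a co-minimal pair in the integers; that is, there exists W ⊆ ℤ such that C is a minimal additive complement to W and W is a minimal additive complement to C. -/
open Pointwise

/-- A covering of `ℤ` by translates of `C` in which every integer is covered only finitely often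
can be thinned out to a minimal one. -/
theorem exists_minimal_complement_subset {C V : Set ℤ} (hV : C + V = Set.univ)
    (hfin : ∀ n : ℤ, {w ∈ V | n - w ∈ C}.Finite) : ∃ W ⊆ V, MinAddComp W C := by
  obtain ⟨W, hW⟩ := zorn_superset {W : Set ℤ | W ⊆ V ∧ W + C = Set.univ} (by
    intro 𝒞 h𝒞 hchain
    rcases 𝒞.eq_empty_or_nonempty with rfl | hne
    · exact ⟨V, ⟨subset_rfl, by rw [add_comm, hV]⟩, by simp⟩
    refine ⟨⋂₀ 𝒞, ⟨?_, ?_⟩, fun s hs => Set.sInter_subset_of_mem hs⟩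
    · obtain ⟨s, hs⟩ := hne
      exact (Set.sInter_subset_of_mem hs).trans (h𝒞 hs).1
    · refine Set.eq_univ_of_forall fun n => ?_
      set R := {w ∈ V | n - w ∈ C} with hR
      obtain ⟨s, hs, hmin⟩ := exists_minimalFor_of_wellFoundedLT (· ∈ 𝒞)
        (fun s => (s ∩ R).ncard) hne
      obtain ⟨w, hw, t, ht, rfl⟩ : n ∈ s + C := by rw [(h𝒞 hs).2]; trivial
      have hwR : w ∈ R := ⟨(h𝒞 hs).1 hw, by simpa using ht⟩
      refine ⟨w, fun s' hs' => ?_, t, ht, rfl⟩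
      rcases hchain.total hs hs' with h | h
      · exact h hw
      · have hsub : s' ∩ R ⊆ s ∩ R := Set.inter_subset_inter_left R h
        have hfs : (s ∩ R).Finite := (hfin _).subset Set.inter_subset_right
        have heq := Set.eq_of_subset_of_ncard_le hsub
          (hmin hs' (Set.ncard_le_ncard hsub hfs)) hfs
        exact (heq ▸ (⟨hw, hwR⟩ : w ∈ s ∩ R) : w ∈ s' ∩ R).1)
  refine ⟨W, hW.prop.1, hW.prop.2, fun W' hW' h => ?_⟩
  exact hW'.2 (hW.le_of_le ⟨hW'.1.trans hW.prop.1, h⟩ hW'.1)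

/-- `C` contains arbitrarily far pairs of neighbouring elements at arbitrarily large distance. -/
def HasLargeGaps (C : Set ℤ) : Prop :=
  ∀ L B : ℤ, ∃ u ∈ C, ∃ v ∈ C, B ≤ u ∧ u + L ≤ v ∧ ∀ t ∈ C, t ≤ u ∨ v ≤ t

theorem HasLargeGaps.exists_gt_forall_sub_notMem {C : Set ℤ} (hC : HasLargeGaps C) (W : Finset ℤ)
    (K : ℤ) : ∃ n > K, ∀ w ∈ W, n - w ∉ C := by
  obtain ⟨B, hB⟩ := W.bddAbove
  obtain ⟨A, hA⟩ := W.bddBelow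
  obtain ⟨u, -, v, -, hu, huv, hgap⟩ := hC (B - A + 2) (K - B)
  refine ⟨u + B + 1, by omega, fun w hw hmem => ?_⟩
  have h1 : w ≤ B := hB hw
  have h2 : A ≤ w := hA hw
  rcases hgap _ hmem with h | h <;> omega

/-- Finitely many translates of `C` can be added to a finite family `W` of translates, without
touching `[-K, K]`, so as to cover the rest of a larger interval `[-K', K']` which contains a point
that is covered only through the element `c` of `C`. -/
theorem HasLargeGaps.exists_extension {C : Set ℤ} (hC : HasLargeGaps C) (hpos : ∀ t ∈ C, 0 ≤ t)
    {c : ℤ} (hc : c ∈ C) (W : Finset ℤ) {K : ℤ} (hK : 0 ≤ K)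
    (hW : ∀ n, |n| ≤ K → ∃ w ∈ W, n - w ∈ C) :
    ∃ (W' : Finset ℤ) (K' : ℤ), W ⊆ W' ∧ K < K' ∧
      (∀ w ∈ W', w ∉ W → ∀ t ∈ C, K < |w + t|) ∧
      (∀ n, |n| ≤ K' → ∃ w ∈ W', n - w ∈ C) ∧
      ∃ x, |x| ≤ K' ∧ ∀ w ∈ W', x - w ∈ C → x - w = c := by
  classical
  have hc0 := hpos c hc
  obtain ⟨u, -, a, ha, -, hua, hagap⟩ := hC (2 * K + c + 1) 0
  set W₁ := W ∪ (Finset.Ioc K (K + c)).image (· - a) with hW₁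
  obtain ⟨x, ⟨hKx, hx⟩, hxmin⟩ : ∃ x : ℤ, (K < x ∧ ∀ w ∈ W₁, x - w ∉ C) ∧
      ∀ n, (K < n ∧ ∀ w ∈ W₁, n - w ∉ C) → x ≤ n := by
    obtain ⟨n, hn⟩ := hC.exists_gt_forall_sub_notMem W₁ K
    exact Int.exists_least_of_bdd ⟨K, fun z hz => hz.1.le⟩ ⟨n, hn⟩
  have hxc : K + c < x := by
    by_contra! h
    exact hx (x - a) (by simp [hW₁]; omega) (by simpa using ha)
  obtain ⟨b, hb, v, -, -, hbv, hbgap⟩ := hC (2 * x + 1) 0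
  refine ⟨insert (x - c) W₁ ∪ (Finset.Ico (-x) (-K)).image (· - b), x, ?_, hKx, ?_, ?_, x, ?_, ?_⟩
  · intro w hw
    simp [hW₁, hw]
  · intro w hw hwW t ht
    have ht0 := hpos t ht
    simp only [hW₁, Finset.mem_union, Finset.mem_insert, Finset.mem_image, Finset.mem_Ioc,
      Finset.mem_Ico] at hw
    rw [lt_abs]
    rcases hw with (rfl | hw | ⟨n, hn, rfl⟩) | ⟨n, hn, rfl⟩
    · omega
    · exact absurd hw hwW
    · rcases hagap t ht with h | h <;> omega
    · rcases hbgap t ht with h | h <;> omega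
  · intro n hn
    rw [abs_le] at hn
    by_cases h1 : |n| ≤ K
    · obtain ⟨w, hw, h⟩ := hW n h1
      exact ⟨w, by simp [hW₁, hw], h⟩
    rw [abs_le] at h1
    by_cases h2 : n < 0
    · exact ⟨n - b, by simp; omega, by simpa using hb⟩
    by_cases h3 : n = x
    · exact ⟨x - c, by simp, by simpa [h3] using hc⟩
    by_contra! h
    have := hxmin n ⟨by omega, fun w hw => h w (by simp [hw])⟩
    omega
  · rw [abs_le]; omega
  · intro w hw hmem
    simp only [Finset.mem_union, Finset.mem_insert, Finset.mem_image, Finset.mem_Ico] at hw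
    rcases hw with (rfl | hw) | ⟨n, hn, rfl⟩
    · ring
    · exact absurd hmem (hx w hw)
    · rcases hbgap _ hmem with h | h <;> omega

/-- There is a locally finite covering of `ℤ` by translates of `C` for which every element of `C`
is indispensable. -/
theorem HasLargeGaps.exists_locallyFinite_complement {C : Set ℤ} (hC : HasLargeGaps C)
    (hpos : ∀ t ∈ C, 0 ≤ t) {c : ℕ → ℤ} (hc : Set.range c = C) :
    ∃ V : Set ℤ, C + V = Set.univ ∧ (∀ n : ℤ, {w ∈ V | n - w ∈ C}.Finite) ∧
      ∀ t ∈ C, ∃ x, ∀ w ∈ V, x - w ∈ C → x - w = t := by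
  have hmem : ∀ k, c k ∈ C := fun k => hc ▸ Set.mem_range_self k
  let State := {p : Finset ℤ × ℤ // 0 ≤ p.2 ∧ ∀ n, |n| ≤ p.2 → ∃ w ∈ p.1, n - w ∈ C}
  have hstep : ∀ (k : ℕ) (p : State), ∃ q : State, p.1.1 ⊆ q.1.1 ∧ p.1.2 < q.1.2 ∧
      (∀ w ∈ q.1.1, w ∉ p.1.1 → ∀ t ∈ C, p.1.2 < |w + t|) ∧
      ∃ x, |x| ≤ q.1.2 ∧ ∀ w ∈ q.1.1, x - w ∈ C → x - w = c k := by
    rintro k ⟨⟨W, K⟩, hK, hW⟩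
    obtain ⟨W', K', h1, h2, h3, h4, h5⟩ := hC.exists_extension hpos (hmem k) W hK hW
    exact ⟨⟨(W', K'), hK.trans h2.le, h4⟩, h1, h2, h3, h5⟩
  choose enlarge hsub hlt havoid hwit using hstep
  let start : State := ⟨({-c 0}, 0), le_rfl, fun n hn => ⟨-c 0, by simp, by
    obtain rfl : n = 0 := by simpa using hn
    simpa using hmem 0⟩⟩
  let S : ℕ → State := fun k => Nat.rec start enlarge k
  have hS : ∀ k, S (k + 1) = enlarge k (S k) := fun k => rfl
  have hmonoW : Monotone fun k => (S k).1.1 := monotone_nat_of_le_succ fun k => hsub k (S k)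
  have hmonoK : StrictMono fun k => (S k).1.2 := strictMono_nat_of_lt_succ fun k => hlt k (S k)
  have hstable : ∀ k j, ∀ w ∈ (S j).1.1, ∀ t ∈ C, |w + t| ≤ (S k).1.2 → w ∈ (S k).1.1 := by
    intro k j w hw t ht hle
    induction j with
    | zero => exact hmonoW (Nat.zero_le k) hw
    | succ m ih =>
      rcases le_or_gt (m + 1) k with h | h
      · exact hmonoW h hw
      · by_cases hwm : w ∈ (S m).1.1
        · exact ih hwm
        · have h1 := havoid m (S m) w hw hwm t ht
          have h2 := hmonoK.monotone (Nat.lt_succ_iff.mp h)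
          omega
  have hlarge : ∀ k : ℕ, (k : ℤ) ≤ (S k).1.2 := by
    intro k
    induction k with
    | zero => exact (S 0).2.1
    | succ m ih =>
      have := hlt m (S m)
      rw [← hS] at this
      push_cast
      omega
  have hbound : ∀ n : ℤ, |n| ≤ (S n.natAbs).1.2 := fun n => by
    simpa using hlarge n.natAbs
  refine ⟨⋃ k, (S k).1.1, ?_, ?_, ?_⟩
  · refine Set.eq_univ_of_forall fun n => ?_
    obtain ⟨w, hw, h⟩ := (S n.natAbs).2.2 n (hbound n)
    exact ⟨n - w, h, w, Set.mem_iUnion.2 ⟨_, hw⟩, by simp⟩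
  · intro n
    refine (S n.natAbs).1.1.finite_toSet.subset ?_
    rintro w ⟨hw, h⟩
    obtain ⟨j, hj⟩ := Set.mem_iUnion.1 hw
    exact hstable _ j w hj _ h (by simpa using hbound n)
  · intro t ht
    obtain ⟨k, rfl⟩ := hc ▸ ht
    obtain ⟨x, hx, huniq⟩ := hwit k (S k)
    refine ⟨x, fun w hw h => huniq w ?_ h⟩
    obtain ⟨j, hj⟩ := Set.mem_iUnion.1 hw
    exact hstable (k + 1) j w hj _ h (by simpa using hx)

theorem hasLargeGaps_range {c : ℕ → ℕ} (hmono : StrictMono c)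
    (hgap : ∀ N : ℕ, ∀ i₀ : ℕ, ∃ i ≥ i₀, N ≤ c (i + 1) - c i) :
    HasLargeGaps (Set.range fun i => (c i : ℤ)) := by
  intro L B
  obtain ⟨i, hi, h⟩ := hgap L.toNat B.toNat
  have h1 := hmono.id_le i
  have h2 := hmono (Nat.lt_succ_self i)
  simp only [id, Nat.succ_eq_add_one] at h1 h2
  refine ⟨_, ⟨i, rfl⟩, _, ⟨i + 1, rfl⟩, by dsimp only; omega, by dsimp only; omega, ?_⟩
  rintro _ ⟨j, rfl⟩
  rcases le_or_gt j i with hj | hj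
  · exact Or.inl (Nat.cast_le.2 <| hmono.monotone hj)
  · exact Or.inr (Nat.cast_le.2 <| hmono.monotone (Nat.succ_le_of_lt hj))

/-- If `C = {c 0 < c 1 < ⋯}` is an infinite set of natural numbers with
`limsup (c (i+1) - c i) = ∞`, then `C` belongs to a co-minimal pair in `ℤ`. -/
theorem stmt3 (c : ℕ → ℕ) (hmono : StrictMono c)
    (hgap : ∀ N : ℕ, ∀ i₀ : ℕ, ∃ i ≥ i₀, N ≤ c (i + 1) - c i) :
    ∃ W : Set ℤ, MinAddComp (Set.range fun i => (c i : ℤ)) W ∧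
      MinAddComp W (Set.range fun i => (c i : ℤ)) := by
  obtain ⟨V, hV, hfin, hwit⟩ := (hasLargeGaps_range hmono hgap).exists_locallyFinite_complement
    (by rintro _ ⟨i, rfl⟩; positivity) rfl
  obtain ⟨W, hWV, hW⟩ := exists_minimal_complement_subset hV hfin
  refine ⟨W, ⟨by rw [add_comm, hW.1], fun C' hC' h => hC'.2 fun t ht => ?_⟩, hW⟩
  obtain ⟨x, hx⟩ := hwit t ht
  obtain ⟨s, hs, w, hw, rfl⟩ : x ∈ C' + W := by rw [h]; trivial
  have hst := hx w (hWV hw) (by simpa using hC'.1 hs)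
  simp only [add_sub_cancel_right] at hst
  exact hst ▸ hs
end

section
/- Let C = {c_1 < c_2 < c_3 < ...} be an infinite set of natural numbers with g(C) = ∞, i.e., C has arbitrarily large gaps between consecutive elements. Then there exists a set D of negative integers such that C + D contains every integer z ≤ 0, g(C + D) = ∞, and every integer is finitely (C, D)-represented. -/
open Pointwise

/-- `g(S) = ∞`: the set `S ⊆ ℤ` has arbitrarily large gaps between consecutive elements,
i.e. for every `N` there are consecutive elements `x < y` of `S` with `y - x ≥ N`. -/
def HasArbLargeGaps (S : Set ℤ) : Prop :=
  ∀ N : ℕ, ∃ x ∈ S, ∃ y ∈ S, x < y ∧ (N : ℤ) ≤ y - x ∧ ∀ z ∈ S, z ≤ x ∨ y ≤ z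

/-- `z` is finitely `(A, B)`-represented: `{(a, b) ∈ A × B : a + b = z}` is finite. -/
def FinitelyRepresented (A B : Set ℤ) (z : ℤ) : Prop :=
  {p : ℤ × ℤ | p.1 ∈ A ∧ p.2 ∈ B ∧ p.1 + p.2 = z}.Finite

/-- A strictly increasing sequence with unbounded gaps has large gaps arbitrarily far out. -/
lemma exists_large_gap_ge {c : ℕ → ℕ} (hmono : StrictMono c)
    (hgap : ∀ N : ℕ, ∃ i : ℕ, N ≤ c (i + 1) - c i) (N m : ℕ) :
    ∃ i, m ≤ i ∧ c i + N ≤ c (i + 1) := by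
  obtain ⟨i, hi⟩ := hgap (N + c m + 1)
  refine ⟨i, ?_, by omega⟩
  by_contra! h
  have := hmono.monotone (show i + 1 ≤ m by omega)
  omega

/-- A set of integers unbounded in both directions which misses arbitrarily long intervals
has arbitrarily large gaps. -/
lemma hasArbLargeGaps_of_windows {S : Set ℤ} (hlow : ∀ a : ℤ, ∃ x ∈ S, x ≤ a)
    (hhigh : ∀ b : ℤ, ∃ y ∈ S, b ≤ y)
    (hwin : ∀ N : ℕ, ∃ a b : ℤ, a < b ∧ (N : ℤ) ≤ b - a ∧ ∀ z ∈ S, z ≤ a ∨ b ≤ z) :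
    HasArbLargeGaps S := by
  intro N
  obtain ⟨a, b, hab, hN, hz⟩ := hwin N
  obtain ⟨x₀, hx₀, hx₀a⟩ := hlow a
  obtain ⟨y₀, hy₀, hy₀b⟩ := hhigh b
  obtain ⟨x, ⟨hx, hxa⟩, hxmax⟩ := Int.exists_greatest_of_bdd (P := fun z => z ∈ S ∧ z ≤ a)
    ⟨a, fun z h => h.2⟩ ⟨x₀, hx₀, hx₀a⟩
  obtain ⟨y, ⟨hy, hyb⟩, hymin⟩ := Int.exists_least_of_bdd (P := fun z => z ∈ S ∧ b ≤ z)
    ⟨b, fun z h => h.2⟩ ⟨y₀, hy₀, hy₀b⟩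
  refine ⟨x, hx, y, hy, by omega, by omega, fun z hzS => ?_⟩
  rcases hz z hzS with h | h
  · exact Or.inl (hxmax z ⟨hzS, h⟩)
  · exact Or.inr (hymin z ⟨hzS, h⟩)

/-- Inductive choice of gaps: `i k` opens a window missed by the translates of `c` by at most
`r k`, and the next translate `r (k + 1) = k + c (n k)` jumps over that window. -/
lemma exists_gap_sequences {c : ℕ → ℕ} (hmono : StrictMono c)
    (hgap : ∀ N : ℕ, ∃ i : ℕ, N ≤ c (i + 1) - c i) :
    ∃ i n r : ℕ → ℕ, ∀ k, r (k + 1) = k + c (n k) ∧ c (i k) + (r k + k + 1) ≤ c (i k + 1) ∧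
      c (i k + 1) ≤ c (n k) ∧ c (n k) + (c (i k + 1) + k) ≤ c (n k + 1) := by
  have step : ∀ k r : ℕ, ∃ i n, c i + (r + k + 1) ≤ c (i + 1) ∧ c (i + 1) ≤ c n ∧
      c n + (c (i + 1) + k) ≤ c (n + 1) := by
    intro k r
    obtain ⟨i, -, hi⟩ := exists_large_gap_ge hmono hgap (r + k + 1) 0
    obtain ⟨n, hin, hn⟩ := exists_large_gap_ge hmono hgap (c (i + 1) + k) (i + 1)
    exact ⟨i, n, hi, hmono.monotone hin, hn⟩
  choose I J h using step
  let r : ℕ → ℕ := fun k => Nat.rec 0 (fun k s => k + c (J k s)) k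
  exact ⟨fun k => I k (r k), fun k => J k (r k), r, fun k => ⟨rfl, h k (r k)⟩⟩

/-- If `C = {c 0 < c 1 < ⋯}` is an infinite set of natural numbers with `g(C) = ∞`,
then there is a set `D` of negative integers with `C + D ⊇ ℤ_{≤0}`, `g(C + D) = ∞`,
and every integer finitely `(C, D)`-represented. -/
theorem stmt5 (c : ℕ → ℕ) (hmono : StrictMono c)
    (hgap : ∀ N : ℕ, ∃ i : ℕ, N ≤ c (i + 1) - c i) :
    ∃ D : Set ℤ, D ⊆ {z : ℤ | z < 0} ∧
      (∀ z : ℤ, z ≤ 0 → z ∈ (Set.range fun i => (c i : ℤ)) + D) ∧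
      HasArbLargeGaps ((Set.range fun i => (c i : ℤ)) + D) ∧
      (∀ z : ℤ, FinitelyRepresented (Set.range fun i => (c i : ℤ)) D z) := by
  obtain ⟨i, n, r, h⟩ := exists_gap_sequences hmono hgap
  have hM : Monotone fun k => c (i k + 1) := monotone_nat_of_le_succ fun k => by
    obtain ⟨h₁, h₂, h₃, h₄⟩ := h k
    obtain ⟨-, h₅, -, -⟩ := h (k + 1)
    change c (i k + 1) ≤ c (i (k + 1) + 1)
    omega
  have hr : Monotone r := monotone_nat_of_le_succ fun k => by
    obtain ⟨h₁, h₂, h₃, h₄⟩ := h k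
    omega
  have havoid : ∀ m j, (c m : ℤ) - r (j + 1) ≤ -j ∨
      (c (i j + 1) : ℤ) ≤ c m - r (j + 1) := by
    intro m j
    obtain ⟨h₁, h₂, h₃, h₄⟩ := h j
    rcases Nat.lt_or_ge (n j) m with hm | hm
    · have := hmono.monotone (show n j + 1 ≤ m from hm)
      omega
    · have := hmono.monotone hm
      omega
  have hcover : ∀ z : ℤ, z ≤ 0 →
      z ∈ (Set.range fun i => (c i : ℤ)) + Set.range fun j => -(r (j + 1) : ℤ) := by
    intro z hz
    obtain ⟨k, rfl⟩ : ∃ k : ℕ, z = -k := ⟨z.natAbs, by omega⟩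
    refine Set.mem_add.2 ⟨_, ⟨n k, rfl⟩, _, ⟨k, rfl⟩, ?_⟩
    have := (h k).1
    dsimp only
    omega
  refine ⟨Set.range fun j => -(r (j + 1) : ℤ), ?_, hcover,
    hasArbLargeGaps_of_windows ?_ ?_ ?_, ?_⟩
  · rintro _ ⟨j, rfl⟩
    obtain ⟨h₁, h₂, h₃, h₄⟩ := h j
    simp only [Set.mem_ofPred_eq]
    omega
  · exact fun a => ⟨min a 0, hcover _ (min_le_right _ _), min_le_left _ _⟩
  · intro b
    refine ⟨_, Set.add_mem_add ⟨b.toNat + r 1, rfl⟩ ⟨0, rfl⟩, ?_⟩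
    have := hmono.le_apply (x := b.toNat + r 1)
    simp only [Nat.zero_add]
    omega
  · intro k
    obtain ⟨-, hk, -, -⟩ := h k
    refine ⟨c (i k), c (i k + 1) - r k, by omega, by omega, ?_⟩
    rintro _ ⟨_, ⟨m, rfl⟩, _, ⟨j, rfl⟩, rfl⟩
    dsimp only
    rcases Nat.lt_or_ge j k with hj | hj
    · have hrj := hr (show j + 1 ≤ k from hj)
      rcases Nat.lt_or_ge (i k) m with hm | hm
      · have := hmono.monotone (show i k + 1 ≤ m from hm)
        omega
      · have := hmono.monotone hm
        omega
    · have hMj : c (i k + 1) ≤ c (i j + 1) := hM hj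
      rcases havoid m j with ha | ha <;> omega
  · intro z
    refine ((Finset.range (z.natAbs + 1)).finite_toSet.image
      fun j => (z + (r (j + 1) : ℤ), -(r (j + 1) : ℤ))).subset ?_
    rintro ⟨_, _⟩ ⟨⟨m, rfl⟩, ⟨j, rfl⟩, hz⟩
    dsimp only at hz
    refine ⟨j, ?_, ?_⟩
    · obtain ⟨-, hj, -, -⟩ := h j
      simp only [Finset.coe_range, Set.mem_Iio]
      rcases havoid m j with ha | ha <;> omega
    · simp only [Prod.mk.injEq, and_true]
      omega
end

section
/- Let C = {c_1 < c_2 < c_3 < ...} be an infinite set of natural numbers with g(C) = ∞, i.e., C has arbitrarily large gaps between consecutive elements. Then there exists W ⊆ ℤ such that C is a minimal additive complement to W and every integer is finitely (C, W)-represented. -/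
open Pointwise

/-- A translate of `C` can contain `z` while avoiding any prescribed interval just below `z`. -/
lemma exists_translate_avoiding_below (c : ℕ → ℕ) (hmono : StrictMono c)
    (hgap : ∀ N : ℕ, ∃ i : ℕ, N ≤ c (i + 1) - c i) (A z : ℤ) :
    ∃ w : ℤ, (∃ j, w + c j = z) ∧ ∀ j, A ≤ w + c j → z ≤ w + c j := by
  obtain ⟨i, hi⟩ := hgap ((z - A).toNat + 1)
  refine ⟨z - c (i + 1), ⟨i + 1, by ring⟩, fun j hj => ?_⟩
  rcases Nat.lt_or_ge i j with h | h
  · have := hmono.monotone (show i + 1 ≤ j from h)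
    omega
  · have := hmono.monotone h
    omega

/-- A translate of `C` can contain `z` while avoiding any prescribed interval just above `z`. -/
lemma exists_translate_avoiding_above (c : ℕ → ℕ) (hmono : StrictMono c)
    (hgap : ∀ N : ℕ, ∃ i : ℕ, N ≤ c (i + 1) - c i) (B z : ℤ) :
    ∃ w : ℤ, (∃ j, w + c j = z) ∧ ∀ j, w + c j ≤ B → w + c j ≤ z := by
  obtain ⟨i, hi⟩ := hgap ((B - z).toNat + 1)
  refine ⟨z - c i, ⟨i, by ring⟩, fun j hj => ?_⟩
  rcases Nat.lt_or_ge i j with h | h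
  · have := hmono.monotone (show i + 1 ≤ j from h)
    omega
  · have := hmono.monotone h
    omega

/-- Finitely many translates of a set with unbounded gaps miss arbitrarily large integers. -/
lemma exists_gt_forall_add_ne (c : ℕ → ℕ) (hmono : StrictMono c)
    (hgap : ∀ N : ℕ, ∃ i : ℕ, N ≤ c (i + 1) - c i) (F : Finset ℤ) (M : ℤ) :
    ∃ n : ℤ, M < n ∧ ∀ w ∈ F, ∀ j, w + c j ≠ n := by
  obtain ⟨R, hR⟩ : ∃ R : ℕ, ∀ x ∈ insert M F, x.natAbs ≤ R :=
    ⟨(insert M F).sup Int.natAbs, fun x hx => Finset.le_sup (f := Int.natAbs) hx⟩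
  obtain ⟨i, hi⟩ := hgap (2 * R + 2)
  have hM := hR M (Finset.mem_insert_self _ _)
  refine ⟨c i + R + 1, by omega, fun w hw j hj => ?_⟩
  have hw' := hR w (Finset.mem_insert_of_mem hw)
  rcases Nat.lt_or_ge i j with h | h
  · have := hmono.monotone (show i + 1 ≤ j from h)
    omega
  · have := hmono.monotone h
    omega

/-- Enlarge a finite `W` whose sums with `C` cover `[A, B]`, without new sums in `[A, B]`, so that
a strictly larger interval is covered and some `n` in it is represented through `c k` only. -/
lemma exists_extension (c : ℕ → ℕ) (hmono : StrictMono c)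
    (hgap : ∀ N : ℕ, ∃ i : ℕ, N ≤ c (i + 1) - c i) (k : ℕ) (W : Finset ℤ) (A B : ℤ)
    (hAB : A ≤ B + 1) (hcov : ∀ z, A ≤ z → z ≤ B → ∃ w ∈ W, ∃ j, w + (c j : ℤ) = z) :
    ∃ (W' : Finset ℤ) (A' B' : ℤ), A' ≤ A - 1 ∧ B + 1 ≤ B' ∧ W ⊆ W' ∧
      (∀ z, A' ≤ z → z ≤ B' → ∃ w ∈ W', ∃ j, w + (c j : ℤ) = z) ∧
      (∀ w ∈ W', ∀ j, A ≤ w + (c j : ℤ) → w + (c j : ℤ) ≤ B → w ∈ W) ∧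
      ∃ n, A' ≤ n ∧ n ≤ B' ∧ n - c k ∈ W' ∧ ∀ w ∈ W', ∀ j, w + (c j : ℤ) = n → j = k := by
  classical
  choose f hf hfA using exists_translate_avoiding_below c hmono hgap A
  set V := W ∪ (Finset.Ioc B (B + c k)).image f with hV
  have hn : ∃ n : ℕ, ∀ w ∈ V, ∀ j, w + (c j : ℤ) ≠ B + c k + 1 + n := by
    obtain ⟨n, hn, h⟩ := exists_gt_forall_add_ne c hmono hgap V (B + c k)
    refine ⟨(n - (B + c k + 1)).toNat, fun w hw j hj => h w hw j ?_⟩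
    omega
  obtain ⟨n, hn_eq⟩ : ∃ n : ℤ, n = B + c k + 1 + Nat.find hn := ⟨_, rfl⟩
  have hn_not : ∀ w ∈ V, ∀ j, w + (c j : ℤ) ≠ n := hn_eq ▸ Nat.find_spec hn
  obtain ⟨u, ⟨i, hi⟩, hu⟩ := exists_translate_avoiding_above c hmono hgap n (A - 1)
  have hWV : W ⊆ V := Finset.subset_union_left
  have hVW' : V ⊆ insert u (insert (n - c k) V) :=
    (Finset.subset_insert _ _).trans (Finset.subset_insert _ _)
  refine ⟨insert u (insert (n - c k) V), A - 1, n, le_rfl, by omega, hWV.trans hVW', ?_, ?_,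
    n, by omega, le_rfl, by simp, ?_⟩
  · intro z hz hzn
    rcases eq_or_lt_of_le hz with rfl | hz
    · exact ⟨u, by simp, i, hi⟩
    rcases le_or_gt z B with hzB | hzB
    · obtain ⟨w, hw, h⟩ := hcov z (by omega) hzB
      exact ⟨w, hVW' (hWV hw), h⟩
    rcases le_or_gt z (B + c k) with hzk | hzk
    · refine ⟨f z, hVW' (Finset.mem_union_right _ (Finset.mem_image_of_mem f ?_)), hf z⟩
      exact Finset.mem_Ioc.2 ⟨hzB, hzk⟩
    rcases eq_or_lt_of_le hzn with rfl | hzn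
    · exact ⟨z - c k, by simp, k, by ring⟩
    have hmin := Nat.find_min hn (m := (z - (B + c k + 1)).toNat) (by omega)
    push Not at hmin
    obtain ⟨w, hw, j, hj⟩ := hmin
    exact ⟨w, hVW' hw, j, by omega⟩
  · intro w hw j hA hB
    rcases Finset.mem_insert.1 hw with rfl | hw
    · have := hu j (by omega)
      omega
    rcases Finset.mem_insert.1 hw with rfl | hw
    · omega
    rcases Finset.mem_union.1 hw with hw | hw
    · exact hw
    obtain ⟨z, hz, rfl⟩ := Finset.mem_image.1 hw
    have := hfA z j hA
    have := (Finset.mem_Ioc.1 hz).1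
    omega
  · intro w hw j hj
    rcases Finset.mem_insert.1 hw with rfl | hw
    · have := hu j hj.le
      omega
    rcases Finset.mem_insert.1 hw with rfl | hw
    · exact hmono.injective (by omega)
    · exact absurd hj (hn_not w hw j)

/-- If `C = {c 0 < c 1 < ⋯}` is an infinite set of natural numbers with `g(C) = ∞`,
then `C` is a minimal additive complement to some `W ⊆ ℤ` such that every integer is
finitely `(C, W)`-represented. -/
theorem stmt6 (c : ℕ → ℕ) (hmono : StrictMono c)
    (hgap : ∀ N : ℕ, ∃ i : ℕ, N ≤ c (i + 1) - c i) :
    ∃ W : Set ℤ, MinAddComp (Set.range fun i => (c i : ℤ)) W ∧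
      ∀ z : ℤ, FinitelyRepresented (Set.range fun i => (c i : ℤ)) W z := by
  let S := {s : Finset ℤ × ℤ × ℤ // s.2.1 ≤ s.2.2 + 1 ∧
    ∀ z, s.2.1 ≤ z → z ≤ s.2.2 → ∃ w ∈ s.1, ∃ j, w + (c j : ℤ) = z}
  have hstep : ∀ (k : ℕ) (s : S), ∃ t : S, t.1.2.1 ≤ s.1.2.1 - 1 ∧ s.1.2.2 + 1 ≤ t.1.2.2 ∧
      s.1.1 ⊆ t.1.1 ∧
      (∀ w ∈ t.1.1, ∀ j, s.1.2.1 ≤ w + (c j : ℤ) → w + (c j : ℤ) ≤ s.1.2.2 → w ∈ s.1.1) ∧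
      ∃ n, t.1.2.1 ≤ n ∧ n ≤ t.1.2.2 ∧ n - c k ∈ t.1.1 ∧
        ∀ w ∈ t.1.1, ∀ j, w + (c j : ℤ) = n → j = k := by
    rintro k ⟨⟨W, A, B⟩, hAB, hcov⟩
    obtain ⟨W', A', B', hA, hB, hW, hcov', hnew, hn⟩ :=
      exists_extension c hmono hgap k W A B hAB hcov
    exact ⟨⟨(W', A', B'), by dsimp only at *; omega, hcov'⟩, hA, hB, hW, hnew, hn⟩
  choose next hA hB hW hnew hpriv using hstep
  let s : ℕ → S := fun k => Nat.rec ⟨(∅, 0, -1), by simp, fun z h₁ h₂ => by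
    dsimp only at h₁ h₂; omega⟩ (fun k t => next k t) k
  have hs : ∀ k, s (k + 1) = next k (s k) := fun k => rfl
  have hsA : ∀ k : ℕ, (s k).1.2.1 ≤ -k := by
    intro k
    induction k with
    | zero => simp [s]
    | succ k ih => have := hA k (s k); rw [hs]; push_cast; omega
  have hsB : ∀ k : ℕ, (k : ℤ) - 1 ≤ (s k).1.2.2 := by
    intro k
    induction k with
    | zero => simp [s]
    | succ k ih => have := hB k (s k); rw [hs]; push_cast; omega
  have hWmono : Monotone fun k => (s k).1.1 := monotone_nat_of_le_succ fun k => hW k (s k)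
  have hAanti : Antitone fun k => (s k).1.2.1 :=
    antitone_nat_of_succ_le fun k => by have := hA k (s k); rw [hs]; omega
  have hBmono : Monotone fun k => (s k).1.2.2 :=
    monotone_nat_of_le_succ fun k => by have := hB k (s k); rw [hs]; omega
  have hstable : ∀ k m, ∀ w ∈ (s m).1.1, ∀ j, (s k).1.2.1 ≤ w + (c j : ℤ) →
      w + (c j : ℤ) ≤ (s k).1.2.2 → w ∈ (s k).1.1 := by
    intro k m
    induction m with
    | zero => intro w hw; simp [s] at hw
    | succ m ih =>
      intro w hw j h₁ h₂
      rcases Nat.lt_or_ge m k with h | h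
      · exact hWmono (show m + 1 ≤ k from h) hw
      · exact ih w (hnew m (s m) w hw j ((hAanti h).trans h₁) (h₂.trans (hBmono h))) j h₁ h₂
  have hmem : ∀ z : ℤ, ∃ k, (s k).1.2.1 ≤ z ∧ z ≤ (s k).1.2.2 := fun z =>
    ⟨z.natAbs + 1, by have := hsA (z.natAbs + 1); omega,
      by have := hsB (z.natAbs + 1); omega⟩
  refine ⟨{w | ∃ k, w ∈ (s k).1.1}, ⟨?_, ?_⟩, ?_⟩
  · refine Set.eq_univ_of_forall fun z => ?_
    obtain ⟨k, h₁, h₂⟩ := hmem z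
    obtain ⟨w, hw, j, hj⟩ := (s k).2.2 z h₁ h₂
    exact Set.mem_add.2 ⟨c j, ⟨j, rfl⟩, w, ⟨k, hw⟩, by omega⟩
  · intro C' hC' huniv
    obtain ⟨hsub, hne⟩ := Set.ssubset_iff_exists.1 hC'
    obtain ⟨_, ⟨k, rfl⟩, hk⟩ := hne
    obtain ⟨n, h₁, h₂, -, huniq⟩ := hpriv k (s k)
    obtain ⟨x, hx, w, ⟨m, hw⟩, hxw⟩ := Set.mem_add.1 (huniv ▸ Set.mem_univ n)
    obtain ⟨j, rfl⟩ := hsub hx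
    dsimp only at hxw hx hk
    have hw' : w ∈ (s (k + 1)).1.1 :=
      hstable (k + 1) m w hw j (by rw [hs]; omega) (by rw [hs]; omega)
    obtain rfl := huniq w hw' j (by omega)
    exact hk hx
  · intro z
    obtain ⟨k, h₁, h₂⟩ := hmem z
    refine ((s k).1.1.finite_toSet.image fun w => (z - w, w)).subset ?_
    rintro ⟨x, w⟩ ⟨⟨j, rfl⟩, ⟨m, hw⟩, hz⟩
    dsimp only at hz
    refine ⟨w, hstable k m w hw j (by omega) (by omega), ?_⟩
    simp [← hz]
end

section
/- If C is a set of integers such that g(ℤ \ C) = ∞ (equivalently, C contains arbitrarily long intervals of consecutive integers), then C is not a minimal additive complement to any finite set of integers. -/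
open Pointwise

/-- If `C ⊆ ℤ` satisfies `g(ℤ \ C) = ∞`, then `C` is not a minimal additive complement
to any finite set of integers. -/
theorem stmt7 (C : Set ℤ) (hgap : HasArbLargeGaps Cᶜ)
    (W : Set ℤ) (hW : W.Finite) :
    ¬ MinAddComp C W := by
  rintro ⟨hcover, hmin⟩
  have hrep (z : ℤ) : ∃ c ∈ C, ∃ w ∈ W, c + w = z :=
    Set.mem_add.mp (hcover ▸ Set.mem_univ z)
  -- `W` has at least two elements, since `C` is not all of `ℤ`.
  have htwo : ∀ w ∈ W, ∃ w' ∈ W, w' ≠ w := by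
    intro w hw
    by_contra! h
    obtain ⟨x, hx, -⟩ := hgap 0
    obtain ⟨c, hc, w', hw', hcw⟩ := hrep (x + w)
    obtain rfl := h w' hw'
    exact hx (add_right_cancel hcw ▸ hc)
  obtain ⟨a, ha⟩ := hW.bddBelow
  obtain ⟨b, hb⟩ := hW.bddAbove
  set M : ℕ := (b - a).toNat
  -- The point `x + M + 1` of `C` is redundant when all of `(x, x + 2 * M + 2)` lies in `C`.
  obtain ⟨x, -, y, -, -, hlen, hbetween⟩ := hgap (2 * M + 2)
  have hmem (z : ℤ) (hxz : x < z) (hzy : z < y) : z ∈ C := by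
    by_contra hz
    have := hbetween z hz
    omega
  have hmid : x + M + 1 ∈ C := hmem _ (by omega) (by omega)
  refine hmin (C \ {x + M + 1}) (Set.sdiff_singleton_ssubset.mpr hmid)
    (Set.eq_univ_of_forall fun z => Set.mem_add.mpr ?_)
  obtain ⟨c, hc, w, hw, rfl⟩ := hrep z
  by_cases hcm : c = x + M + 1
  · obtain ⟨w', hw', hne⟩ := htwo w hw
    have h₁ := ha hw
    have h₂ := ha hw'
    have h₃ := hb hw
    have h₄ := hb hw'
    refine ⟨c + w - w', ⟨hmem _ (by omega) (by omega), ?_⟩, w', hw', by ring⟩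
    rw [Set.mem_singleton_iff]
    omega
  · exact ⟨c, ⟨hc, hcm⟩, w, hw, rfl⟩
end

section
/- Let G be an abelian group, H ⊆ G a subgroup, and suppose C ⊆ G is H-invariant (i.e., H + C = C). Then C arises as a minimal additive complement in G if and only if the image C/H of C under the projection G → G/H arises as a minimal additive complement in G/H. Moreover, in this case C is a minimal additive complement to some W ⊆ G and C/H is a minimal additive complement to some S ⊆ G/H with |W| = |S| (i.e., W and S can be chosen of the same cardinality). -/
open Pointwise

/-- `C` is a minimal additive complement to `W` in the abelian group `G`. -/
def MinAddCompG {G : Type*} [AddCommGroup G] (C W : Set G) : Prop :=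
  C + W = Set.univ ∧ ∀ C' : Set G, C' ⊂ C → C' + W ≠ Set.univ

/-- `C` is a minimal additive complement to `W` iff `C + W` is everything and each `c ∈ C` has a
sum `c + w` that no other element of `C` contributes to. -/
theorem minAddCompG_iff {G : Type*} [AddCommGroup G] {C W : Set G} :
    MinAddCompG C W ↔ C + W = Set.univ ∧
      ∀ c ∈ C, ∃ w ∈ W, ∀ c' ∈ C, ∀ w' ∈ W, c' + w' = c + w → c' = c := by
  refine and_congr_right fun hCW => ⟨fun hmin c hc => ?_, fun hpriv C' hC' hC'W => ?_⟩
  · by_contra! hcon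
    refine hmin (C \ {c}) (Set.sdiff_singleton_ssubset.2 hc) (Set.eq_univ_of_forall fun g => ?_)
    obtain ⟨a, ha, w, hw, rfl⟩ := Set.mem_add.1 (hCW ▸ Set.mem_univ g)
    by_cases hac : a = c
    · subst hac
      obtain ⟨c', hc', w', hw', heq, hne⟩ := hcon w hw
      exact heq ▸ Set.add_mem_add ⟨hc', hne⟩ hw'
    · exact Set.add_mem_add ⟨ha, hac⟩ hw
  · obtain ⟨c, hc, hcC'⟩ := Set.exists_of_ssubset hC'
    obtain ⟨w, -, hw⟩ := hpriv c hc
    obtain ⟨c', hc', w', hw', heq⟩ := Set.mem_add.1 (hC'W ▸ Set.mem_univ (c + w))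
    exact hcC' (hw c' (hC'.1 hc') w' hw' heq ▸ hc')

theorem add_mem_of_subgroup_add_eq {G : Type*} [AddCommGroup G] {H : AddSubgroup G} {C : Set G}
    (hinv : (H : Set G) + C = C) {c h : G} (hc : c ∈ C) (hh : h ∈ H) : c + h ∈ C := by
  rw [← hinv, add_comm c h]
  exact Set.add_mem_add hh hc

theorem MinAddCompG.image_mk' {G : Type*} [AddCommGroup G] {H : AddSubgroup G} {C W : Set G}
    (hinv : (H : Set G) + C = C) (hCW : MinAddCompG C W) :
    MinAddCompG (QuotientAddGroup.mk' H '' C) (QuotientAddGroup.mk' H '' W) := by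
  obtain ⟨hsum, hpriv⟩ := minAddCompG_iff.1 hCW
  refine minAddCompG_iff.2 ⟨?_, ?_⟩
  · rw [← Set.image_add, hsum, Set.image_univ_of_surjective (QuotientAddGroup.mk'_surjective H)]
  · rintro _ ⟨c, hc, rfl⟩
    obtain ⟨w, hw, hcw⟩ := hpriv c hc
    refine ⟨_, ⟨w, hw, rfl⟩, ?_⟩
    rintro _ ⟨c', hc', rfl⟩ _ ⟨w', hw', rfl⟩ heq
    rw [← map_add, ← map_add] at heq
    obtain ⟨h, hh, heq⟩ := (QuotientAddGroup.mk'_eq_mk' H).1 heq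
    refine (QuotientAddGroup.mk'_eq_mk' H).2 ⟨h, hh, ?_⟩
    exact hcw _ (add_mem_of_subgroup_add_eq hinv hc' hh) w' hw' (by rw [← heq]; abel)

theorem MinAddCompG.of_image_mk' {G : Type*} [AddCommGroup G] {H : AddSubgroup G} {C W : Set G}
    (hinv : (H : Set G) + C = C) (hinj : Set.InjOn (QuotientAddGroup.mk' H) W)
    (hCW : MinAddCompG (QuotientAddGroup.mk' H '' C) (QuotientAddGroup.mk' H '' W)) :
    MinAddCompG C W := by
  obtain ⟨hsum, hpriv⟩ := minAddCompG_iff.1 hCW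
  refine minAddCompG_iff.2 ⟨Set.eq_univ_of_forall fun g => ?_, fun c hc => ?_⟩
  · obtain ⟨_, ⟨c, hc, rfl⟩, _, ⟨w, hw, rfl⟩, heq⟩ :=
      Set.mem_add.1 (hsum ▸ Set.mem_univ (QuotientAddGroup.mk' H g))
    rw [← map_add] at heq
    obtain ⟨h, hh, rfl⟩ := (QuotientAddGroup.mk'_eq_mk' H).1 heq
    exact ⟨c + h, add_mem_of_subgroup_add_eq hinv hc hh, w, hw, add_right_comm c h w⟩
  · obtain ⟨_, ⟨w, hw, rfl⟩, hcw⟩ := hpriv _ ⟨c, hc, rfl⟩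
    refine ⟨w, hw, fun c' hc' w' hw' heq => ?_⟩
    have hq := congrArg (QuotientAddGroup.mk' H) heq
    rw [map_add, map_add] at hq
    have hcc' := hcw _ ⟨c', hc', rfl⟩ _ ⟨w', hw', rfl⟩ hq
    rw [hcc'] at hq
    rw [hinj hw' hw (add_left_cancel hq)] at heq
    exact add_right_cancel heq

theorem MinAddCompG.exists_lift {G : Type*} [AddCommGroup G] {H : AddSubgroup G} {C : Set G}
    (hinv : (H : Set G) + C = C) {S : Set (G ⧸ H)}
    (hCS : MinAddCompG (QuotientAddGroup.mk' H '' C) S) :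
    ∃ W : Set G, MinAddCompG C W ∧ Nonempty (W ≃ S) := by
  obtain ⟨W, -, hW⟩ := Set.SurjOn.exists_bijOn_subset
    (Set.surjOn_univ.2 (QuotientAddGroup.mk'_surjective H) |>.mono subset_rfl (Set.subset_univ S))
  exact ⟨W, .of_image_mk' hinv hW.injOn (hW.image_eq.symm ▸ hCS), ⟨hW.equiv _⟩⟩

/-- Let `H` be a subgroup of an abelian group `G` and `C ⊆ G` be `H`-invariant.
Then `C` arises as a minimal additive complement in `G` iff `C/H` arises as a minimal
additive complement in `G ⧸ H`; moreover, in this case witnesses `W ⊆ G` and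
`S ⊆ G ⧸ H` can be chosen with the same cardinality. -/
theorem stmt8 {G : Type*} [AddCommGroup G] (H : AddSubgroup G) (C : Set G)
    (hinv : (H : Set G) + C = C) :
    ((∃ W : Set G, MinAddCompG C W) ↔
      ∃ S : Set (G ⧸ H), MinAddCompG ((QuotientAddGroup.mk' H) '' C) S) ∧
    ((∃ W : Set G, MinAddCompG C W) →
      ∃ (W : Set G) (S : Set (G ⧸ H)),
        MinAddCompG C W ∧ MinAddCompG ((QuotientAddGroup.mk' H) '' C) S ∧
        Nonempty (W ≃ S)) := by
  refine ⟨⟨fun ⟨W, hW⟩ => ⟨_, hW.image_mk' hinv⟩, fun ⟨S, hS⟩ => ?_⟩, fun ⟨W, hW⟩ => ?_⟩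
  · obtain ⟨W, hW, -⟩ := hS.exists_lift hinv
    exact ⟨W, hW⟩
  · have hS := hW.image_mk' hinv
    obtain ⟨W', hW', e⟩ := hS.exists_lift hinv
    exact ⟨W', _, hW', hS, e⟩
end

section
/- Let G be a finite abelian group and let C, W ⊆ G be such that for every proper subset D of C one has D + W ≠ C + W. If |W| = k > 1, then |C| ≤ (k/(2k−1))·|G|. -/
open Pointwise

/-- If no element of `C` can be removed without shrinking `C + W`, then every element of `C` takes
part in a sum which has a unique representation. -/
theorem exists_unique_sum_of_minimal {G : Type*} [AddCommGroup G] [DecidableEq G]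
    {C W : Finset G} (hmin : ∀ D : Finset G, D ⊂ C → D + W ≠ C + W) {c : G} (hc : c ∈ C) :
    ∃ w ∈ W, ∀ c' ∈ C, ∀ w' ∈ W, c' + w' = c + w → c' = c := by
  by_contra! h
  refine hmin _ (Finset.erase_ssubset hc)
    ((Finset.add_subset_add_right (Finset.erase_subset c C)).antisymm fun x hx ↦ ?_)
  obtain ⟨a, ha, w, hw, rfl⟩ := Finset.mem_add.1 hx
  by_cases hac : a = c
  · subst hac
    obtain ⟨c', hc', w', hw', heq, hne⟩ := h w hw
    exact heq ▸ Finset.add_mem_add (Finset.mem_erase.2 ⟨hne, hc'⟩) hw'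
  · exact Finset.add_mem_add (Finset.mem_erase.2 ⟨hac, ha⟩) hw

/-- A minimal summand `C` of `C + W` satisfies `|C| (|W| - 1) ≤ |G \ C| |W|`. -/
theorem card_mul_pred_le_of_minimal {G : Type*} [AddCommGroup G] [Fintype G] [DecidableEq G]
    {C W : Finset G} (hmin : ∀ D : Finset G, D ⊂ C → D + W ≠ C + W) :
    C.card * (W.card - 1) ≤ Cᶜ.card * W.card := by
  choose! f hfW hf using fun c (hc : c ∈ C) ↦ exists_unique_sum_of_minimal hmin hc
  have hcard : (C.sigma fun c ↦ W.erase (f c)).card = C.card * (W.card - 1) := by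
    rw [Finset.card_sigma, Finset.sum_congr rfl fun c hc ↦ Finset.card_erase_of_mem (hfW c hc),
      Finset.sum_const, smul_eq_mul]
  rw [← hcard, ← Finset.card_product]
  refine Finset.card_le_card_of_injOn (fun p ↦ (p.1 + f p.1 - p.2, p.2)) ?_ ?_
  · rintro ⟨c, w⟩ hp
    simp only [Finset.coe_sigma, Set.mem_sigma_iff, Finset.mem_coe, Finset.mem_erase] at hp
    obtain ⟨hc, hne, hw⟩ := hp
    simp only [Finset.coe_product, Set.mem_prod, Finset.mem_coe, Finset.mem_compl]
    refine ⟨fun hmem ↦ hne ?_, hw⟩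
    have h := hf c hc _ hmem w hw (sub_add_cancel _ _)
    rw [add_sub_assoc, add_eq_left, sub_eq_zero] at h
    exact h.symm
  · rintro ⟨c, w⟩ hp ⟨c', w'⟩ hp' heq
    simp only [Finset.coe_sigma, Set.mem_sigma_iff, Finset.mem_coe] at hp hp'
    obtain ⟨h, rfl⟩ := Prod.mk.inj heq
    obtain rfl := hf c' hp'.1 c hp.1 (f c) (hfW c hp.1) (sub_left_injective h)
    rfl

/-- Let `G` be a finite abelian group and `C, W ⊆ G` such that removing any element of
`C` strictly shrinks the sumset `C + W`. If `|W| = k > 1`, then `|C| ≤ (k/(2k-1))·|G|`. -/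
theorem stmt9 {G : Type*} [AddCommGroup G] [Fintype G] [DecidableEq G]
    (C W : Finset G) (k : ℕ) (hk : 1 < k) (hW : W.card = k)
    (hmin : ∀ D : Finset G, D ⊂ C → D + W ≠ C + W) :
    (C.card : ℝ) ≤ (k : ℝ) / (2 * k - 1) * Fintype.card G := by
  have h := card_mul_pred_le_of_minimal hmin
  rw [hW] at h
  have hle : (C.card : ℝ) * (k - 1) ≤ Cᶜ.card * k := by
    have := (Nat.cast_le (α := ℝ)).2 h
    rwa [Nat.cast_mul, Nat.cast_mul, Nat.cast_sub hk.le, Nat.cast_one] at this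
  have hsum : (C.card : ℝ) + Cᶜ.card = Fintype.card G := by
    exact_mod_cast Finset.card_add_card_compl C
  have hk' : (1 : ℝ) < k := by exact_mod_cast hk
  rw [div_mul_eq_mul_div, le_div_iff₀ (by linarith), ← hsum]
  linarith
end

section
/- Suppose C ⊆ ℤ is a minimal additive complement to a set W ⊆ ℤ with |W| = k ≥ 2. Then the upper Banach density of C satisfies b̄(C) ≤ k/(2k−1). -/
open Pointwise

/-- The `n`-th term of the sequence defining the upper Banach density of `A ⊆ ℤ`:
`max_{x ∈ ℤ} |A ∩ [x+1, x+n]| / n`.  The upper Banach density is the limit of this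
sequence as `n → ∞`, which always exists. -/
noncomputable def upperBanachSeq (A : Set ℤ) (n : ℕ) : ℝ :=
  sSup {r : ℝ | ∃ x : ℤ, r = (Set.ncard (A ∩ Set.Icc (x + 1) (x + n)) : ℝ) / n}

/-- Every element `c` of a minimal complement has a sum `c + w` not represented by any other
element of the complement. -/
lemma MinAddComp.exists_unrepeated_sum {C W : Set ℤ} (h : MinAddComp C W) {c : ℤ} (hc : c ∈ C) :
    ∃ w ∈ W, ∀ c' ∈ C, ∀ w' ∈ W, c' + w' = c + w → c' = c := by
  have hne := h.2 (C \ {c}) (Set.sdiff_singleton_ssubset.2 hc)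
  obtain ⟨z, hz⟩ := (Set.ne_univ_iff_exists_notMem _).1 hne
  have key : ∀ c' ∈ C, ∀ w' ∈ W, c' + w' = z → c' = c := by
    intro c' hc' w' hw' he
    by_contra hcc
    exact hz (Set.mem_add.2 ⟨c', ⟨hc', hcc⟩, w', hw', he⟩)
  obtain ⟨c', hc', w, hw, he⟩ := Set.mem_add.1 (h.1 ▸ Set.mem_univ z : z ∈ C + W)
  obtain rfl := key c' hc' w hw he
  exact ⟨w, hw, he ▸ key⟩

/-- Double counting of the pairs consisting of an element of `C` and a non-element of `C` that is
excluded by an unrepeated sum. -/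
lemma MinAddComp.card_window_le {C : Set ℤ} {W : Finset ℤ} (h : MinAddComp C W) {M : ℕ}
    (hM : ∀ w ∈ W, |w| ≤ M) (x : ℤ) (n : ℕ) :
    (2 * (W.card : ℝ) - 1) * (C ∩ Set.Icc (x + 1) (x + n)).ncard ≤ W.card * (n + 4 * M) := by
  classical
  choose! f hfW hf using fun c (hc : c ∈ C) => h.exists_unrepeated_sum hc
  let J : Finset ℤ := Finset.Icc (x + 1 - 2 * M) (x + n + 2 * M)
  let A : Finset ℤ := (Finset.Icc (x + 1) (x + n)).filter (· ∈ C)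
  have hA : (C ∩ Set.Icc (x + 1) (x + n)).ncard = A.card := by
    rw [← Set.ncard_coe_finset]
    congr 1
    ext y
    simp only [A, Set.mem_inter_iff, Set.mem_Icc, Finset.coe_filter, Finset.mem_Icc,
      Set.mem_ofPred_eq, and_comm]
  have hAC : ∀ c ∈ A, c ∈ C := fun c hc => (Finset.mem_filter.1 hc).2
  have hcount : A.card * (W.card - 1) ≤ (J.filter (· ∉ C)).card * W.card := by
    have h1 : (A.sigma fun c => W.erase (f c)).card = A.card * (W.card - 1) := by
      rw [Finset.card_sigma]
      exact Finset.sum_const_nat fun c hc => Finset.card_erase_of_mem (hfW c (hAC c hc))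
    rw [← h1, ← Finset.card_product]
    refine Finset.card_le_card_of_injOn (fun p => (p.1 + f p.1 - p.2, p.2)) ?_ ?_
    · rintro ⟨c, w⟩ hp
      obtain ⟨hcA, hw⟩ := Finset.mem_sigma.1 hp
      obtain ⟨hne, hwW⟩ := Finset.mem_erase.1 hw
      have hcC := hAC c hcA
      have b1 := abs_le.1 (hM w hwW)
      have b2 := abs_le.1 (hM _ (hfW c hcC))
      have b3 := Finset.mem_Icc.1 (Finset.mem_filter.1 hcA).1
      simp only [Finset.coe_product, Set.mem_prod, Finset.mem_coe, Finset.mem_filter, J,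
        Finset.mem_Icc] at *
      refine ⟨⟨⟨by omega, by omega⟩, fun hmem => hne ?_⟩, hwW⟩
      have := hf c hcC _ hmem w hwW (by ring)
      omega
    · rintro ⟨c, w⟩ hp ⟨c', w'⟩ hp' he
      have hc := hAC c (Finset.mem_sigma.1 hp).1
      have hc' := hAC c' (Finset.mem_sigma.1 hp').1
      simp only [Prod.mk.injEq] at he
      obtain ⟨he, rfl⟩ := he
      obtain rfl := hf c' hc' c hc (f c) (hfW c hc) (by omega)
      rfl
  have hsplit : (J.filter (· ∉ C)).card + A.card ≤ n + 4 * M := by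
    have hJ : J.card = n + 4 * M := by
      simp only [J, Int.card_Icc]
      omega
    rw [← hJ, ← Finset.card_filter_add_card_filter_not (s := J) (· ∈ C), add_comm]
    gcongr
    intro y hy
    simp only [A, J, Finset.mem_filter, Finset.mem_Icc] at hy ⊢
    exact ⟨by omega, hy.2⟩
  rw [hA]
  have h2 : (A.card : ℝ) * (W.card - 1) ≤ (J.filter (· ∉ C)).card * W.card := by
    rcases Nat.eq_zero_or_pos W.card with h0 | h0
    · rw [h0]
      simp
    · have := (Nat.cast_le (α := ℝ)).2 hcount
      push_cast [Nat.cast_sub h0] at this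
      exact this
  have h3 : ((J.filter (· ∉ C)).card : ℝ) + A.card ≤ n + 4 * M := by exact_mod_cast hsplit
  nlinarith [mul_le_mul_of_nonneg_right h3 (Nat.cast_nonneg (α := ℝ) W.card)]

/-- If `C ⊆ ℤ` is a minimal additive complement to a set `W` of size `k ≥ 2`, then the
upper Banach density of `C` is at most `k/(2k-1)`.  (Since the limit defining the upper
Banach density exists, it equals the limsup of the defining sequence.) -/
theorem stmt11 (C W : Set ℤ) (k : ℕ) (hk : 2 ≤ k) (hWfin : W.Finite) (hW : W.ncard = k)
    (hmac : MinAddComp C W) :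
    Filter.limsup (upperBanachSeq C) Filter.atTop ≤ (k : ℝ) / (2 * k - 1) := by
  lift W to Finset ℤ using hWfin
  rw [Set.ncard_coe_finset] at hW
  subst hW
  obtain ⟨M, hM⟩ : ∃ M : ℕ, ∀ w ∈ W, |w| ≤ M := by
    refine ⟨W.sup Int.natAbs, fun w hw => ?_⟩
    rw [Int.abs_eq_natAbs]
    exact_mod_cast Finset.le_sup (f := Int.natAbs) hw
  have hk' : (2 : ℝ) ≤ W.card := by exact_mod_cast hk
  have hpos : (0 : ℝ) < 2 * W.card - 1 := by linarith
  set L : ℝ := (W.card : ℝ) / (2 * W.card - 1) with hL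
  have hL0 : 0 ≤ L := by positivity
  have hlim : Filter.Tendsto (fun n : ℕ => L + L * (4 * M) / n) Filter.atTop (nhds L) := by
    simpa using tendsto_const_nhds.add (tendsto_const_div_atTop_nhds_zero_nat (L * (4 * M)))
  rw [← hlim.limsup_eq]
  refine Filter.limsup_le_limsup ?_ ?_ hlim.isBoundedUnder_le
  · filter_upwards [Filter.eventually_gt_atTop 0] with n hn
    have hn' : (0 : ℝ) < n := by exact_mod_cast hn
    refine Real.sSup_le ?_ (by positivity)
    rintro r ⟨x, rfl⟩
    have := hmac.card_window_le hM x n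
    rw [div_le_iff₀ hn', add_mul, div_mul_cancel₀ _ hn'.ne', ← mul_add, hL, div_mul_eq_mul_div,
      le_div_iff₀ hpos]
    linarith
  · refine Filter.IsBoundedUnder.isCoboundedUnder_le
      (Filter.isBoundedUnder_of ⟨0, fun n => ?_⟩)
    refine Real.sSup_nonneg ?_
    rintro r ⟨x, rfl⟩
    positivity
end

section
/- Let C = 2ℕ ∪ B ∪ F, where B is a finite subset of the nonpositive even integers 2ℤ_{≤0} and F is a finite subset of the odd integers 2ℤ + 1. Then C arises as a minimal additive complement in ℤ if and only if there exists W ⊆ ℤ such that 2ℤ \ (2ℕ ∪ B) = W + F. -/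
open Pointwise

/-- A complement is minimal iff every element `c` of it has a witness all of whose
representations use `c`. -/
theorem minAddComp_iff (C W : Set ℤ) :
    MinAddComp C W ↔ C + W = Set.univ ∧
      ∀ c ∈ C, ∃ z, ∀ c' ∈ C, ∀ w ∈ W, c' + w = z → c' = c := by
  refine and_congr_right fun _ => ⟨fun h c hc => ?_, fun h C' hC' hu => ?_⟩
  · by_contra! hcon
    refine h (C \ {c}) ⟨Set.sdiff_subset, fun hs => (hs hc).2 rfl⟩ ?_
    refine Set.eq_univ_of_forall fun z => ?_
    obtain ⟨c', hc', w, hw, hz, hne⟩ := hcon z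
    exact ⟨c', ⟨hc', hne⟩, w, hw, hz⟩
  · obtain ⟨c, hc, hcC'⟩ := Set.exists_of_ssubset hC'
    obtain ⟨z, hz⟩ := h c hc
    obtain ⟨c', hc', w, hw, hcw⟩ : z ∈ C' + W := hu ▸ Set.mem_univ z
    exact hcC' (hz c' (hC'.1 hc') w hw hcw ▸ hc')

/-- If only the part of `W` of the parity of `p` is unbounded below, the other part is a
single point, and this exhibits the even integers outside `E` as a sumset with `F`. -/
theorem exists_diff_eq_add_of_minAddComp {E F W : Set ℤ} (hE : ∀ x ∈ E, Even x)
    (hE0 : ∀ x, Even x → 0 ≤ x → x ∈ E) (hF : ∀ x ∈ F, Odd x)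
    (hmin : MinAddComp (E ∪ F) W) (p : ℤ)
    (hunb : ∀ L, ∃ w ∈ W, Even (w - p) ∧ w < L)
    (hbdd : ∃ m, ∀ w ∈ W, ¬ Even (w - p) → m ≤ w) :
    ∃ V : Set ℤ, {z : ℤ | Even z} \ E = V + F := by
  obtain ⟨hcover, huniq⟩ := (minAddComp_iff _ _).1 hmin
  obtain ⟨m, hm⟩ := hbdd
  have key : ∀ c ∈ E, ∃ v ∈ W, ¬ Even (v - p) ∧
      ∀ c' ∈ E ∪ F, ∀ w ∈ W, c' + w = c + v → c' = c := by
    intro c hc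
    obtain ⟨z, hz⟩ := huniq c (Or.inl hc)
    have hzp : ¬ Even (z - p) := by
      intro hev
      obtain ⟨w₁, hw₁, he₁, hl₁⟩ := hunb z
      obtain ⟨w₂, hw₂, he₂, hl₂⟩ := hunb w₁
      have h₁ := hz (z - w₁) (Or.inl (hE0 _ (by grind) (by lia))) w₁ hw₁ (by ring)
      have h₂ := hz (z - w₂) (Or.inl (hE0 _ (by grind) (by lia))) w₂ hw₂ (by ring)
      lia
    obtain ⟨c', hc', w, hw, hcw⟩ : z ∈ E ∪ F + W := hcover ▸ Set.mem_univ z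
    have hcc : c' = c := hz c' hc' w hw hcw
    have hce := hE c hc
    have hcw' : c' + w = z := hcw
    subst hcc
    refine ⟨w, hw, by grind, fun c'' hc'' w' hw' h => hz c'' hc'' w' hw' (by lia)⟩
  have hsub : ∀ w₁ ∈ W, ¬ Even (w₁ - p) → ∀ w₂ ∈ W, ¬ Even (w₂ - p) → w₁ = w₂ := by
    intro w₁ hw₁ ho₁ w₂ hw₂ ho₂
    have hm₁ := hm w₁ hw₁ ho₁
    have hm₂ := hm w₂ hw₂ ho₂
    have hce : Even (2 * (w₁ - m + (w₂ - m))) := even_two_mul _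
    obtain ⟨v, hv, hvo, hvu⟩ := key (2 * (w₁ - m + (w₂ - m))) (hE0 _ hce (by lia))
    have hmv := hm v hv hvo
    have h₁ := hvu (2 * (w₁ - m + (w₂ - m)) + v - w₁)
      (Or.inl (hE0 _ (by grind) (by lia))) w₁ hw₁ (by ring)
    have h₂ := hvu (2 * (w₁ - m + (w₂ - m)) + v - w₂)
      (Or.inl (hE0 _ (by grind) (by lia))) w₂ hw₂ (by ring)
    lia
  obtain ⟨v, hv, hvo, -⟩ := key 0 (hE0 0 (by simp) le_rfl)
  refine ⟨{x | ∃ w ∈ W, Even (w - p) ∧ x = w - v}, ?_⟩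
  ext x
  constructor
  · rintro ⟨hx, hxE⟩
    have hx : Even x := hx
    obtain ⟨c, hc, w, hw, hcw⟩ : x + v ∈ E ∪ F + W := hcover ▸ Set.mem_univ _
    have hcw : c + w = x + v := hcw
    rcases hc with hc | hc
    · have hce := hE c hc
      have := hsub w hw (by grind) v hv hvo
      exact absurd (by rwa [show x = c by lia]) hxE
    · have hco := hF c hc
      exact ⟨w - v, ⟨w, hw, by grind, rfl⟩, c, hc, show w - v + c = x by lia⟩
  · rintro ⟨_, ⟨w, hw, hwe, rfl⟩, f, hf, rfl⟩
    have hfo := hF f hf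
    refine ⟨show Even (w - v + f) by grind, fun hxE => ?_⟩
    have hxE : w - v + f ∈ E := hxE
    obtain ⟨u, hu, huo, huu⟩ := key _ hxE
    have huv := hsub u hu huo v hv hvo
    have := huu f (Or.inr hf) w hw (by lia)
    have := hE _ hxE
    grind

/-- Only one parity class of a set complemented minimally by `E ∪ F` is unbounded below. -/
theorem exists_diff_eq_add {E F W : Set ℤ} (hE : ∀ x ∈ E, Even x)
    (hE0 : ∀ x, Even x → 0 ≤ x → x ∈ E) (hF : ∀ x ∈ F, Odd x)
    {N : ℤ} (hEN : ∀ x ∈ E, -N < x) (hFN : ∀ x ∈ F, -N < x)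
    (hmin : MinAddComp (E ∪ F) W) :
    ∃ V : Set ℤ, {z : ℤ | Even z} \ E = V + F := by
  obtain ⟨hcover, huniq⟩ := (minAddComp_iff _ _).1 hmin
  by_cases h0 : ∀ L, ∃ w ∈ W, Even (w - 0) ∧ w < L
  · by_cases h1 : ∀ L, ∃ w ∈ W, Even (w - 1) ∧ w < L
    · exfalso
      obtain ⟨z, hz⟩ := huniq 0 (Or.inl (hE0 0 (by simp) le_rfl))
      obtain ⟨p, hp, hpz⟩ : ∃ p : ℤ, (∀ L, ∃ w ∈ W, Even (w - p) ∧ w < L) ∧ Even (z - p) := by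
        rcases Int.even_or_odd z with h | h
        · exact ⟨0, h0, by grind⟩
        · exact ⟨1, h1, by grind⟩
      obtain ⟨w, hw, he, hl⟩ := hp z
      have := hz (z - w) (Or.inl (hE0 _ (by grind) (by lia))) w hw (by ring)
      lia
    · push Not at h1
      obtain ⟨m, hm⟩ := h1
      exact exists_diff_eq_add_of_minAddComp hE hE0 hF hmin 0 h0
        ⟨m, fun w hw ho => hm w hw (by grind)⟩
  · push Not at h0
    obtain ⟨m, hm⟩ := h0
    refine exists_diff_eq_add_of_minAddComp hE hE0 hF hmin 1 ?_
      ⟨m, fun w hw ho => hm w hw (by grind)⟩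
    by_contra! h1
    obtain ⟨l, hl⟩ := h1
    obtain ⟨c, hc, w, hw, hcw⟩ : min l m - N ∈ E ∪ F + W := hcover ▸ Set.mem_univ _
    have hcw : c + w = min l m - N := hcw
    have hcN : -N < c := hc.elim (hEN c) (hFN c)
    rcases Int.even_or_odd w with h | h
    · have := hm w hw (by grind)
      lia
    · have := hl w hw (by grind)
      lia

/-- A finite set is not contained in a translate of itself with a point removed. -/
theorem Set.Finite.exists_add_ne {F : Set ℤ} (hF : F.Finite) {f : ℤ} (hf : f ∈ F) (t : ℤ) :
    ∃ g ∈ F, ∀ h ∈ F, h ≠ f → g + t ≠ h := by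
  by_contra! hcon
  have hsub : (fun g => g + t) '' F ⊆ F \ {f} := by
    rintro _ ⟨g, hg, rfl⟩
    obtain ⟨h, hh, hne, heq⟩ := hcon g hg
    exact ⟨by simpa [heq] using hh, by simpa [heq] using hne⟩
  have h₁ := Set.ncard_le_ncard hsub (hF.subset Set.sdiff_subset)
  rw [Set.ncard_image_of_injective _ (add_left_injective t)] at h₁
  exact absurd (Set.ncard_sdiff_singleton_lt_of_mem hf hF) (by lia)

/-- If the even integers outside `E` are a sumset with `F`, then the summand can be thinned out
so that adding the point `0` gives a set to which `E ∪ F` is a minimal complement. -/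
theorem exists_minAddComp {E F V : Set ℤ} (hE : ∀ x ∈ E, Even x)
    (hE0 : ∀ x, Even x → 0 ≤ x → x ∈ E) (hF : ∀ x ∈ F, Odd x) (hFfin : F.Finite)
    {N : ℤ} (hN : 0 < N) (hEN : ∀ x ∈ E, -N < x) (hFN : ∀ x ∈ F, -N < x ∧ x < N)
    (hV : {z : ℤ | Even z} \ E = V + F) :
    ∃ W : Set ℤ, MinAddComp (E ∪ F) W := by
  obtain ⟨n, hne, hnN, hsep⟩ : ∃ n : ℤ → ℤ, (∀ f, Even (n f)) ∧
      (∀ f ∈ F, n f ≤ -(10 * N)) ∧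
      ∀ f g, f ≠ g → n f + 10 * N ≤ n g ∨ n g + 10 * N ≤ n f := by
    refine ⟨fun f => -(10 * N * (f + N)), fun f => ⟨-(5 * N * (f + N)), by ring⟩,
      fun f hf => ?_, fun f g hfg => ?_⟩
    · have := (hFN f hf).1
      change -(10 * N * (f + N)) ≤ -(10 * N)
      nlinarith
    · change -(10 * N * (f + N)) + 10 * N ≤ -(10 * N * (g + N)) ∨
        -(10 * N * (g + N)) + 10 * N ≤ -(10 * N * (f + N))
      rcases lt_or_gt_of_ne hfg with h | h
      · right; nlinarith
      · left; nlinarith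
  set U : Set ℤ := {w | Odd w ∧ (∀ f ∈ F, w + f ∉ E) ∧
    ∀ f ∈ F, ∀ g ∈ F, g ≠ f → w ≠ n f - g}
  have hUF : ∀ x, Even x → x ∉ E → ∃ w ∈ U, ∃ f ∈ F, w + f = x := by
    intro x hx hxE
    obtain ⟨w, hw, f, hf, hwf⟩ : x ∈ V + F := hV ▸ ⟨hx, hxE⟩
    have hwf : w + f = x := hwf
    have hwE : ∀ g ∈ F, w + g ∉ E := fun g hg =>
      (show w + g ∈ {z : ℤ | Even z} \ E from hV ▸ Set.add_mem_add hw hg).2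
    by_cases hwU : w ∈ U
    · exact ⟨w, hwU, f, hf, hwf⟩
    have hfo := hF f hf
    have hrem : ∃ f₀ ∈ F, ∃ g₀ ∈ F, g₀ ≠ f₀ ∧ w = n f₀ - g₀ := by
      by_contra! hcon
      exact hwU ⟨by grind, hwE, hcon⟩
    obtain ⟨f₀, hf₀, g₀, hg₀, -, hw₀⟩ := hrem
    obtain ⟨g, hg, hgt⟩ := hFfin.exists_add_ne hf₀ (n f₀ - x)
    have hgo := hF g hg
    have b₁ := hFN f hf
    have b₂ := hFN g₀ hg₀
    have b₃ := hFN g hg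
    have b₄ := hnN f₀ hf₀
    refine ⟨x - g, ⟨by grind, fun h hh hxE' => ?_, fun f₁ hf₁ g₁ hg₁ hne₁ heq => ?_⟩,
      g, hg, by ring⟩
    · have := hEN _ hxE'
      have := hFN h hh
      lia
    · by_cases hff : f₁ = f₀
      · subst hff
        exact hgt g₁ hg₁ hne₁ (by lia)
      · have := hFN g₁ hg₁
        rcases hsep f₁ f₀ hff with h | h <;> lia
  have hUunb : ∀ L, ∃ w ∈ U, w < L := by
    intro L
    have he : Even (2 * (-|L| - N)) := even_two_mul _
    have := neg_abs_le L
    have := abs_nonneg L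
    obtain ⟨w, hw, f, hf, h⟩ := hUF _ he fun h => by have := hEN _ h; lia
    have := hFN f hf
    exact ⟨w, hw, by lia⟩
  refine ⟨insert 0 U, (minAddComp_iff _ _).2 ⟨Set.eq_univ_of_forall fun z => ?_, ?_⟩⟩
  · rcases Int.even_or_odd z with hz | hz
    · by_cases hzE : z ∈ E
      · exact ⟨z, Or.inl hzE, 0, Or.inl rfl, add_zero z⟩
      · obtain ⟨w, hw, f, hf, h⟩ := hUF z hz hzE
        exact ⟨f, Or.inr hf, w, Or.inr hw, show f + w = z by lia⟩
    · obtain ⟨w, hw, hwz⟩ := hUunb z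
      have hwo := hw.1
      exact ⟨z - w, Or.inl (hE0 _ (by grind) (by lia)), w, Or.inr hw, sub_add_cancel z w⟩
  · rintro c (hc | hc)
    · refine ⟨c, ?_⟩
      have hce := hE c hc
      rintro c' hc' w (rfl | hw) h
      · lia
      · have hwo := hw.1
        rcases hc' with hc' | hc'
        · have := hE c' hc'
          grind
        · exact absurd (by rwa [show w + c' = c by lia]) (hw.2.1 c' hc')
    · refine ⟨n c, ?_⟩
      have hnc := hne c
      have hncN := hnN c hc
      rintro c' (hc' | hc') w (rfl | hw) h
      · have := hEN c' hc'
        lia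
      · have hwo := hw.1
        have := hE c' hc'
        grind
      · have := hF c' hc'
        grind
      · by_contra hcc
        exact hw.2.2 c hc c' hc' hcc (by lia)

/-- Let `C = 2ℕ ∪ B ∪ F` with `B` a finite set of nonpositive even integers and `F` a
finite set of odd integers.  Then `C` arises as a minimal additive complement in `ℤ`
iff `2ℤ \ (2ℕ ∪ B) = W + F` for some `W ⊆ ℤ`. -/
theorem stmt12 (B F : Set ℤ) (hBfin : B.Finite) (hB : B ⊆ {z : ℤ | z ≤ 0 ∧ Even z})
    (hFfin : F.Finite) (hF : F ⊆ {z : ℤ | Odd z}) :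
    (∃ W : Set ℤ, MinAddComp ({z : ℤ | ∃ n : ℕ, z = 2 * n} ∪ B ∪ F) W) ↔
      ∃ W : Set ℤ, {z : ℤ | Even z} \ ({z : ℤ | ∃ n : ℕ, z = 2 * n} ∪ B) = W + F := by
  have hE : ∀ x ∈ {z : ℤ | ∃ n : ℕ, z = 2 * n} ∪ B, Even x := by
    rintro x (⟨n, rfl⟩ | hx)
    · exact even_two_mul _
    · exact (hB hx).2
  have hE0 : ∀ x, Even x → 0 ≤ x → x ∈ {z : ℤ | ∃ n : ℕ, z = 2 * n} ∪ B := by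
    rintro x ⟨k, rfl⟩ hx
    exact Or.inl ⟨k.toNat, by lia⟩
  obtain ⟨b, hb⟩ := hBfin.bddBelow
  obtain ⟨l, hl⟩ := hFfin.bddBelow
  obtain ⟨u, hu⟩ := hFfin.bddAbove
  have hb' := neg_abs_le b
  have hl' := neg_abs_le l
  have hu' := le_abs_self u
  have hb0 := abs_nonneg b
  have hl0 := abs_nonneg l
  have hu0 := abs_nonneg u
  have hN : 0 < |b| + |l| + |u| + 1 := by positivity
  have hEN : ∀ x ∈ {z : ℤ | ∃ n : ℕ, z = 2 * n} ∪ B, -(|b| + |l| + |u| + 1) < x := by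
    rintro x (⟨n, rfl⟩ | hx)
    · lia
    · have := hb hx
      lia
  have hFN : ∀ x ∈ F, -(|b| + |l| + |u| + 1) < x ∧ x < |b| + |l| + |u| + 1 := by
    intro x hx
    have := hl hx
    have := hu hx
    lia
  constructor
  · rintro ⟨W, hW⟩
    exact exists_diff_eq_add hE hE0 (fun x hx => hF hx) hEN (fun x hx => (hFN x hx).1) hW
  · rintro ⟨V, hV⟩
    exact exists_minAddComp hE hE0 (fun x hx => hF hx) hFfin hN hEN hFN hV
end

section
/- Let m ∈ ℕ, let A ⊆ ℤ satisfy |A ∩ (z + mℤ)| ≤ 1 for each z ∈ [0, m) (i.e., A contains at most one element from each residue class modulo m), and suppose C ⊆ ℤ contains mℕ + A. If C is a minimal additive complement to W ⊆ ℤ, then for each a ∈ A there exists w_a ∈ W such that a + w_a ∉ A + (W \ {w_a}) + mℤ. -/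
open Pointwise

/-- In a minimal additive complement `C` to `W`, each `c ∈ C` has some `w ∈ W` such that `c + w`
is represented in `C + W` only with the second summand `w`. -/
theorem MinAddComp.exists_unique_right {C W : Set ℤ} (h : MinAddComp C W) {c : ℤ} (hc : c ∈ C) :
    ∃ w ∈ W, ∀ c' ∈ C, ∀ w' ∈ W, c' + w' = c + w → w' = w := by
  have hne := h.2 (C \ {c}) ⟨Set.sdiff_subset, fun hs => (hs hc).2 rfl⟩
  obtain ⟨z, hz⟩ := (Set.ne_univ_iff_exists_notMem _).1 hne
  have hunique : ∀ c' ∈ C, ∀ w' ∈ W, c' + w' = z → c' = c := by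
    intro c' hc' w' hw' hsum
    by_contra hcc
    exact hz (Set.mem_add.2 ⟨c', ⟨hc', hcc⟩, w', hw', hsum⟩)
  obtain ⟨d, hd, w, hw, hdw⟩ := Set.mem_add.1 (h.1 ▸ Set.mem_univ z : z ∈ C + W)
  obtain rfl := hunique d hd w hw hdw
  refine ⟨w, hw, fun c' hc' w' hw' hsum => ?_⟩
  have := hunique c' hc' w' hw' (hsum.trans hdw)
  lia

/-- Let `A ⊆ ℤ` have at most one element in each residue class mod `m`, and suppose
`C ⊇ mℕ + A`.  If `C` is a minimal additive complement to `W`, then for each `a ∈ A`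
there exists `w ∈ W` with `a + w ∉ A + (W \ {w}) + mℤ`. -/
theorem stmt13 (m : ℕ) (A C W : Set ℤ)
    (hA : ∀ a ∈ A, ∀ b ∈ A, (m : ℤ) ∣ (a - b) → a = b)
    (hC : {z : ℤ | ∃ n : ℕ, ∃ a ∈ A, z = m * n + a} ⊆ C)
    (hmac : MinAddComp C W) :
    ∀ a ∈ A, ∃ w ∈ W, a + w ∉ A + (W \ {w}) + {z : ℤ | (m : ℤ) ∣ z} := by
  intro a ha
  by_contra! hcon
  have hrep : ∀ w ∈ W, ∃ a' ∈ A, ∃ w' ∈ W, w' ≠ w ∧ ∃ k : ℤ, a + w = a' + w' + m * k := by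
    intro w hw
    obtain ⟨_, ⟨a', ha', w', ⟨hw', hne⟩, rfl⟩, _, ⟨k, rfl⟩, hsum⟩ := hcon w hw
    exact ⟨a', ha', w', hw', hne, k, hsum.symm⟩
  choose w hw huniq using fun n : ℕ =>
    hmac.exists_unique_right (hC ⟨n, a, ha, rfl⟩ : (m : ℤ) * n + a ∈ C)
  have hneg : ∀ n : ℕ, ∀ a' ∈ A, ∀ w' ∈ W, ∀ k : ℤ, a + w n = a' + w' + m * k →
      0 ≤ n + k → w' = w n := by
    intro n a' ha' w' hw' k hsum hk
    obtain ⟨l, hl⟩ := Int.eq_ofNat_of_zero_le hk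
    refine huniq n (m * l + a') (hC ⟨l, a', ha', rfl⟩) w' hw' ?_
    rw [← hl]
    linear_combination -hsum
  rcases Nat.eq_zero_or_pos m with rfl | hm
  · obtain ⟨a', ha', w', hw', hne, k, hsum⟩ := hrep (w 0) (hw 0)
    exact hne (hneg 0 a' ha' w' hw' 0 (by simpa using hsum) (by simp))
  · have : NeZero m := ⟨hm.ne'⟩
    obtain ⟨r, hr⟩ := Finite.exists_infinite_fiber fun n => (w n : ZMod m)
    rw [Set.infinite_coe_iff] at hr
    obtain ⟨n₀, hn₀⟩ := hr.nonempty
    obtain ⟨a', ha', w', hw', hne, k, hsum⟩ := hrep (w n₀) (hw n₀)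
    obtain ⟨n, hn, hlt⟩ := hr.exists_gt (-k).toNat
    have hmod : (w n₀ : ZMod m) = w n := Eq.trans hn₀ (Eq.symm hn)
    obtain ⟨l, hl⟩ := (ZMod.intCast_eq_intCast_iff_dvd_sub _ _ _).1 hmod
    have heq : w n₀ = w n := by
      rcases le_total 0 l with h | h
      · exact hneg n a ha (w n₀) (hw n₀) l (by linear_combination hl) (by lia)
      · exact (hneg n₀ a ha (w n) (hw n) (-l) (by linear_combination -hl) (by lia)).symm
    rw [heq] at hsum hne
    exact hne (hneg n a' ha' w' hw' k hsum (by lia))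
end

section
/- Fix a finite set F ⊂ ℤ and a set W ⊆ ℤ such that F + W ⊇ ℕ. Then there exists a set W' ⊆ ℤ such that F + W' = F + W and F' + W' ≠ F + W for every proper subset F' of F. -/
open Pointwise

/-- No translate of a finite set `F` of integers is contained in `F` with a point removed. -/
theorem exists_sub_notMem_or_eq {F : Set ℤ} (hF : F.Finite) {f : ℤ} (hf : f ∈ F) (d : ℤ) :
    ∃ h ∈ F, h - d ∉ F ∨ h - d = f := by
  by_contra! hcon
  have hmaps : Set.MapsTo (fun h : ℤ => h - d) F F := fun h hh => (hcon h hh).1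
  have hinj : Set.InjOn (fun h : ℤ => h - d) F := fun x _ y _ hxy => by
    simpa using hxy
  obtain ⟨h, hh, heq⟩ := ((hF.injOn_iff_bijOn_of_mapsTo hmaps).1 hinj).surjOn hf
  exact (hcon h hh).2 heq

/-- Fix a finite nonempty set `F ⊂ ℤ` and `W ⊆ ℤ` with `F + W ⊇ ℕ`.  Then there exists
`W' ⊆ ℤ` with `F + W' = F + W` and `F' + W' ≠ F + W` for every proper subset `F' ⊂ F`. -/
theorem stmt17 (F W : Set ℤ) (hFfin : F.Finite) (hFne : F.Nonempty)
    (hFW : ∀ n : ℕ, (n : ℤ) ∈ F + W) :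
    ∃ W' : Set ℤ, F + W' = F + W ∧ ∀ F' : Set ℤ, F' ⊂ F → F' + W' ≠ F + W := by
  have hnonneg : ∀ z : ℤ, 0 ≤ z → z ∈ F + W := fun z hz => by
    simpa [Int.toNat_of_nonneg hz] using hFW z.toNat
  obtain ⟨B, hB⟩ : ∃ B : ℤ, ∀ f ∈ F, -B ≤ f ∧ f ≤ B := by
    obtain ⟨u, hu⟩ := hFfin.bddAbove
    obtain ⟨l, hl⟩ := hFfin.bddBelow
    refine ⟨max u (-l), fun f hf => ?_⟩
    have h₁ := hu hf
    have h₂ := hl hf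
    omega
  have hB0 : 0 ≤ B := by
    obtain ⟨f, hf⟩ := hFne
    have := hB f hf
    omega
  -- Widely spaced points, one for each `f ∈ F`, which will only be representable through `f`.
  obtain ⟨n, hn_large, hn_sep⟩ : ∃ n : ℤ → ℤ, (∀ f ∈ F, 10 * B + 10 ≤ n f) ∧
      ∀ f f', |n f - n f'| ≤ 4 * B → f = f' := by
    refine ⟨fun f => (10 * B + 10) * (f + B + 1), fun f hf => ?_, fun f f' h => ?_⟩
    · have := (hB f hf).1
      nlinarith
    · rw [abs_le] at h
      by_contra hne
      rcases lt_or_gt_of_ne hne with hlt | hlt <;> nlinarith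
  let R : Set ℤ := {w | ∃ f ∈ F, ∃ g ∈ F, g ≠ f ∧ w = n f - g}
  refine ⟨(W ∪ Set.Ici B) \ R, Set.Subset.antisymm ?_ ?_, fun F' hF' heq => ?_⟩
  · rintro _ ⟨f, hf, w, ⟨hw | hw, -⟩, rfl⟩
    · exact Set.add_mem_add hf hw
    · have h₁ := hB f hf
      have h₂ : B ≤ w := hw
      exact hnonneg (f + w) (by omega)
  · rintro _ ⟨a, ha, w, hw, rfl⟩
    by_cases hwR : w ∈ R
    · obtain ⟨f, hf, g, hg, -, rfl⟩ := hwR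
      obtain ⟨h, hh, hh'⟩ := exists_sub_notMem_or_eq hFfin hf (a - g)
      have hBa := hB a ha
      have hBg := hB g hg
      have hBh := hB h hh
      have hnf := hn_large f hf
      refine ⟨h, hh, a + (n f - g) - h, ⟨Or.inr ?_, ?_⟩, by simp⟩
      · change B ≤ _
        omega
      · rintro ⟨f', hf', g', hg', hne, he⟩
        have hBg' := hB g' hg'
        obtain rfl := hn_sep f f' (by rw [abs_le]; omega)
        have hg'_eq : h - (a - g) = g' := by omega
        rw [hg'_eq] at hh'
        exact hh'.elim (fun h₁ => h₁ hg') hne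
    · exact Set.add_mem_add ha ⟨Or.inl hw, hwR⟩
  · obtain ⟨f, hf, hfF'⟩ := Set.exists_of_ssubset hF'
    have hnf := hn_large f hf
    have hmem := hnonneg (n f) (by omega)
    rw [← heq] at hmem
    obtain ⟨g, hg, w, ⟨-, hwR⟩, hgw⟩ := hmem
    have hgw' : g + w = n f := hgw
    exact hwR ⟨f, hf, g, hF'.1 hg, fun h => hfF' (h ▸ hg), by omega⟩
end

section
/- Let C = (mℕ + A) ∪ B ∪ F be an eventually periodic set of period m, where m is a prime congruent to 2 modulo 3, |F| = 1, and |A| = (m+1)/3. Suppose there exist subsets Y_+, Y_−, Y_0 of ℤ/mℤ with Ȳ = Y_+ ∪ Y_− ∪ Y_0 satisfying: (1) (A_(m) + Ȳ) ∪ (F_(m) + Y_+) = (A_(m) ∪ F_(m)) + Y_− = ℤ/mℤ; (2) for each a ∈ A_(m), there exists y_a ∈ Y_0 such that a + y_a ∈ (F_(m) + Y_−) \ (((A_(m) \ {a}) + Y_0) ∪ (A_(m) + (Y_− ∪ Y_+))); (3) for each f ∈ F_(m), there exists y ∈ Ȳ such that f + y ∉ A_(m) + Y_−; and suppose also (4)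 for each a ∈ A_(m) there exists W ⊆ ℤ such that (mℤ + a) ∩ (ℤ \ C) = (mℤ + a) ∩ (F + W). Then C arises as a minimal additive complement in ℤ. -/
open Pointwise

/-- The projection `S_(m)` of `S ⊆ ℤ` to `ℤ/mℤ`. -/
def projMod (m : ℕ) (S : Set ℤ) : Set (ZMod m) :=
  (fun z : ℤ => (z : ZMod m)) '' S

/-- The set `mℕ + A = {m*n + a : n ∈ ℕ, a ∈ A}`. -/
def mNatAdd (m : ℕ) (A : Set ℤ) : Set ℤ :=
  {z : ℤ | ∃ n : ℕ, ∃ a ∈ A, z = m * n + a}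

theorem ZMod.exists_intCast_eq_and_le (m : ℕ) [NeZero m] (r : ZMod m) (M : ℤ) :
    ∃ c : ℤ, M ≤ c ∧ (c : ZMod m) = r := by
  obtain ⟨x, rfl⟩ := ZMod.intCast_surjective r
  refine ⟨x + m * (|M| + |x|), ?_, by simp⟩
  have hm : (1 : ℤ) ≤ m := by exact_mod_cast NeZero.one_le
  nlinarith [le_abs_self M, neg_abs_le x, abs_nonneg M, abs_nonneg x]

/-- Let `C` be bounded below, contain `f`, have no other element outside the residue classes in `R`,
and contain all large integers of every class in `R`. If the classes `a + y a`, `a ∈ R`, are met by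
`R + y R` only through `a`, and the classes `b + (a + y a - f)` are exactly the others, then
`C` arises as a minimal additive complement. -/
theorem exists_minAddComp_of_residues (m : ℕ) [NeZero m] (C : Set ℤ) (f : ℤ) (R : Set (ZMod m))
    (y : ZMod m → ZMod m) (hbdd : BddBelow C) (hfC : f ∈ C) (hR : R.Nonempty)
    (hCR : ∀ c ∈ C, c = f ∨ (c : ZMod m) ∈ R)
    (hup : ∀ a ∈ R, ∃ N : ℤ, ∀ z : ℤ, N ≤ z → (z : ZMod m) = a → z ∈ C)
    (huniq : ∀ a ∈ R, ∀ b ∈ R, ∀ c ∈ R, b + y c = a + y a → b = a)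
    (hdisj : ∀ a ∈ R, ∀ b ∈ R, ∀ c ∈ R, b + (a + y a - f) ≠ c + y c)
    (hcov : ∀ z, (∀ a ∈ R, z ≠ a + y a) → ∃ b ∈ R, ∃ a ∈ R, z = b + (a + y a - f)) :
    ∃ W : Set ℤ, MinAddComp C W := by
  choose L hL using ZMod.intCast_surjective (n := m)
  obtain ⟨K, hK⟩ := hbdd
  set W : Set ℤ := {w | ∃ a ∈ R, w = L (y a)} ∪
    {w | ∃ a ∈ R, (w : ZMod m) + f = a + y a ∧ w + f - L (y a) ∉ C}
  have key : ∀ a ∈ R, ∀ c ∈ C, ∀ w ∈ W, (c : ZMod m) + w = a + y a →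
      w = L (y a) ∨ (c = f ∧ c + w - L (y a) ∉ C) := by
    rintro a ha c hc w (⟨b, hb, rfl⟩ | ⟨b, hb, hw, hwC⟩) h
    · rw [hL] at h
      rcases hCR c hc with rfl | hcR
      · exact absurd (by rw [← h]; ring) (hdisj a ha b hb b hb)
      · have hca := huniq a ha _ hcR b hb h
        rw [hca] at h
        exact .inl (by rw [add_left_cancel h])
    · rcases hCR c hc with rfl | hcR
      · have hab : b = a := huniq a ha b hb b hb (by rw [← hw, ← h]; ring)
        subst hab
        exact .inr ⟨rfl, by rwa [add_comm c w]⟩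
      · refine absurd ?_ (hdisj b hb _ hcR a ha)
        rw [← h, ← hw]; ring
  refine ⟨W, Set.eq_univ_of_forall fun z => ?_, fun C' hC' hcon => ?_⟩
  · by_cases hz : ∀ a ∈ R, (z : ZMod m) ≠ a + y a
    · obtain ⟨b, hb, a, ha, hzab⟩ := hcov z hz
      obtain ⟨N, hN⟩ := hup b hb
      obtain ⟨c, hc, hcb⟩ := ZMod.exists_intCast_eq_and_le m b (max N (z + f - L (y a) - K + 1))
      refine ⟨c, hN c (le_trans (le_max_left _ _) hc) hcb, z - c, .inr ⟨a, ha, ?_, fun h => ?_⟩,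
        by simp⟩
      · push_cast; rw [hzab, hcb]; ring
      · have h1 := hK h
        have h2 := le_trans (le_max_right _ _) hc
        linarith
    · push Not at hz
      obtain ⟨a, ha, hza⟩ := hz
      by_cases hzC : z - L (y a) ∈ C
      · exact ⟨_, hzC, _, .inl ⟨a, ha, rfl⟩, by simp⟩
      · exact ⟨f, hfC, z - f, .inr ⟨a, ha, by simpa using hza, by simpa using hzC⟩, by simp⟩
  · obtain ⟨hsub, hne⟩ := hC'
    obtain ⟨c, hc, hcC'⟩ := Set.not_subset.1 hne
    have hmem : ∀ z : ℤ, ∃ c' ∈ C', ∃ w ∈ W, c' + w = z := fun z => by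
      have : z ∈ C' + W := hcon ▸ Set.mem_univ z
      exact Set.mem_add.1 this
    rcases hCR c hc with rfl | hcR
    · obtain ⟨a, ha⟩ := hR
      obtain ⟨x, hx, hxa⟩ := ZMod.exists_intCast_eq_and_le m (-(a + y a)) (-(K + L (y a)) + 1)
      obtain ⟨c', hc', w, hw, hz⟩ := hmem (-x)
      have hz' : (c' : ZMod m) + w = a + y a := by
        rw [← Int.cast_add, hz, Int.cast_neg, hxa, neg_neg]
      rcases key a ha c' (hsub hc') w hw hz' with rfl | ⟨rfl, -⟩
      · have := hK (hsub hc')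
        linarith
      · exact hcC' hc'
    · obtain ⟨c', hc', w, hw, hz⟩ := hmem (c + L (y c))
      have hz' : (c' : ZMod m) + w = c + y c := by
        rw [← Int.cast_add, hz, Int.cast_add, hL]
      rcases key _ hcR c' (hsub hc') w hw hz' with rfl | ⟨-, h⟩
      · exact hcC' (add_right_cancel hz ▸ hc')
      · exact h (by rw [hz]; simpa using hc)

/-- Equality case by counting in Cauchy–Davenport: if `|R + S| ≤ p - |T|` because the sets are
disjoint, while `|R| + |S| + |T| = p + 1`, then `R + S` is the complement of `T`. -/
theorem ZMod.mem_add_of_notMem {p : ℕ} (hp : p.Prime) {R S T : Finset (ZMod p)}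
    (hR : R.Nonempty) (hS : S.Nonempty) (hT : T.Nonempty) (hcard : R.card + S.card + T.card = p + 1)
    (hdisj : Disjoint (R + S) T) {z : ZMod p} (hz : z ∉ T) : z ∈ R + S := by
  have : Fact p.Prime := ⟨hp⟩
  have hcd := ZMod.cauchy_davenport hp hR hS
  have hpos := hT.card_pos
  rw [min_eq_right (by omega)] at hcd
  have huniv : (R + S) ∪ T = Finset.univ := by
    apply Finset.eq_univ_of_card
    have hle := Finset.card_le_univ ((R + S) ∪ T)
    rw [Finset.card_union_of_disjoint hdisj] at hle ⊢
    rw [ZMod.card] at hle ⊢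
    omega
  exact (Finset.mem_union.1 (huniv ▸ Finset.mem_univ z)).resolve_right hz

/-- Let `C = (mℕ + A) ∪ B ∪ F` be an eventually periodic set of prime period
`m ≡ 2 (mod 3)`, with `|F| = 1` and `|A| = (m+1)/3` (where `A` has one element per
residue class, so `|A| = |A_(m)|`).  If Conditions (1)–(3) of the necessary criteria hold
for some `Y₊, Y₋, Y₀ ⊆ ℤ/mℤ`, and Condition (4) holds, then `C` arises as a minimal
additive complement in `ℤ`. -/
theorem stmt18 (m : ℕ) (hm : Nat.Prime m) (hm3 : m % 3 = 2) (A B F : Set ℤ)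
    (hA : A.Nonempty) (hBfin : B.Finite) (hFfin : F.Finite)
    (hBA : projMod m B ⊆ projMod m A) (hFA : projMod m F ∩ projMod m A = ∅)
    (hAinj : ∀ a ∈ A, ∀ b ∈ A, (m : ℤ) ∣ (a - b) → a = b)
    (hAfin : A.Finite) (hAcard : 3 * A.ncard = m + 1) (hFcard : F.ncard = 1)
    (hY : ∃ Yp Ym Y0 : Set (ZMod m),
      ((projMod m A + (Yp ∪ Ym ∪ Y0)) ∪ (projMod m F + Yp) = Set.univ ∧
        (projMod m A ∪ projMod m F) + Ym = Set.univ) ∧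
      (∀ a ∈ projMod m A, ∃ ya ∈ Y0,
        a + ya ∈ (projMod m F + Ym) \
          (((projMod m A \ {a}) + Y0) ∪ (projMod m A + (Ym ∪ Yp)))) ∧
      (∀ f ∈ projMod m F, ∃ y ∈ Yp ∪ Ym ∪ Y0, f + y ∉ projMod m A + Ym))
    (hcover : ∀ a : ZMod m, a ∈ projMod m A → ∃ W : Set ℤ,
      {z : ℤ | (z : ZMod m) = a} ∩ (mNatAdd m A ∪ B ∪ F)ᶜ =
        {z : ℤ | (z : ZMod m) = a} ∩ (F + W)) :
    ∃ W : Set ℤ, MinAddComp (mNatAdd m A ∪ B ∪ F) W := by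
  have : Fact m.Prime := ⟨hm⟩
  classical
  obtain ⟨f, rfl⟩ := Set.ncard_eq_one.1 hFcard
  obtain ⟨Yp, Ym, Y0, -, hY2, -⟩ := hY
  choose! y hyY0 hy using hY2
  have huniq : ∀ a ∈ projMod m A, ∀ b ∈ projMod m A, ∀ c ∈ projMod m A,
      b + y c = a + y a → b = a := by
    intro a ha b hb c hc h
    by_contra hne
    exact (hy a ha).2 (.inl ⟨b, ⟨hb, hne⟩, y c, hyY0 c hc, h⟩)
  have hYm : ∀ a ∈ projMod m A, a + y a - f ∈ Ym := by
    intro a ha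
    obtain ⟨_, ⟨_, rfl, rfl⟩, s, hs, h⟩ := (hy a ha).1
    simpa [← h] using hs
  have hdisj : ∀ a ∈ projMod m A, ∀ b ∈ projMod m A, ∀ c ∈ projMod m A,
      b + (a + y a - f) ≠ c + y c := fun a ha b hb c hc h =>
    (hy c hc).2 (.inr ⟨b, hb, _, .inl (hYm a ha), h⟩)
  refine exists_minAddComp_of_residues m _ f (projMod m A) y ?_ (.inr rfl) (hA.image _) ?_ ?_
    huniq hdisj ?_
  · refine (BddBelow.union ?_ hBfin.bddBelow).union hFfin.bddBelow
    obtain ⟨K, hK⟩ := hAfin.bddBelow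
    refine ⟨K, ?_⟩
    rintro _ ⟨n, a, ha, rfl⟩
    have := hK ha
    have : (0 : ℤ) ≤ m * n := by positivity
    linarith
  · rintro c ((⟨n, a, ha, rfl⟩ | hc) | hc)
    · exact .inr ⟨a, ha, by simp⟩
    · exact .inr (hBA ⟨c, hc, rfl⟩)
    · exact .inl hc
  · rintro _ ⟨a, ha, rfl⟩
    refine ⟨a, fun z hz hza => .inl (.inl ?_)⟩
    obtain ⟨k, hk⟩ := (ZMod.intCast_eq_intCast_iff_dvd_sub a z m).1 hza.symm
    have hk0 : 0 ≤ k := by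
      have hmpos : (0 : ℤ) < m := by exact_mod_cast hm.pos
      by_contra! hneg
      nlinarith
    lift k to ℕ using hk0
    exact ⟨k, a, ha, by linarith⟩
  · intro z hz
    have hRfin : (projMod m A).Finite := Set.toFinite _
    set R := hRfin.toFinset
    have hRcard : R.card = A.ncard := by
      rw [← Set.ncard_eq_toFinset_card _ hRfin]
      refine Set.InjOn.ncard_image fun a ha b hb hab => hAinj a ha b hb ?_
      exact (ZMod.intCast_eq_intCast_iff_dvd_sub b a m).1 hab.symm
    have hRne : R.Nonempty := hRfin.toFinset_nonempty.2 (hA.image _)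
    have hmem : ∀ {a}, a ∈ R ↔ a ∈ projMod m A := by simp [R]
    set T := R.image fun a => a + y a
    have hTcard : T.card = R.card := Finset.card_image_of_injOn fun a ha b hb hab =>
      huniq b (hmem.1 hb) a (hmem.1 ha) a (hmem.1 ha) hab
    set S := T.image fun t => t - (f : ZMod m)
    have hScard : S.card = T.card := Finset.card_image_of_injective _ sub_left_injective
    have hzRS : z ∈ R + S := by
      refine ZMod.mem_add_of_notMem hm hRne (S := S) (T := T) ((hRne.image _).image _)
        (hRne.image _) (by omega) ?_ ?_
      · rw [Finset.disjoint_left]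
        intro x hx hxT
        obtain ⟨b, hb, s, hs, rfl⟩ := Finset.mem_add.1 hx
        simp only [S, T, Finset.mem_image, exists_exists_and_eq_and] at hs
        simp only [T, Finset.mem_image] at hxT
        obtain ⟨a, ha, rfl⟩ := hs
        obtain ⟨c, hc, h⟩ := hxT
        exact hdisj a (hmem.1 ha) b (hmem.1 hb) c (hmem.1 hc) h.symm
      · simp only [T, Finset.mem_image, not_exists, not_and]
        exact fun a ha h => hz a (hmem.1 ha) h.symm
    obtain ⟨b, hb, s, hs, rfl⟩ := Finset.mem_add.1 hzRS
    simp only [S, T, Finset.mem_image, exists_exists_and_eq_and] at hs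
    obtain ⟨a, ha, rfl⟩ := hs
    exact ⟨b, hmem.1 hb, a, hmem.1 ha, rfl⟩
end

section
/- Every set of the form 3ℕ ∪ F, where F is a finite nonempty subset of 3ℕ + 1 = {1, 4, 7, ...}, arises as a minimal additive complement in ℤ. -/
open Pointwise

/-- A finite set `G` of nonnegative integers has a complement `B` relative to the negative integers
for which every element of `G` is needed. -/
theorem exists_neg_complement (G : Finset ℤ) (hne : G.Nonempty) (hG : ∀ g ∈ G, 0 ≤ g) :
    ∃ B : Set ℤ, (∀ y < 0, ∃ g ∈ G, y - g ∈ B) ∧ (∀ b ∈ B, ∀ g ∈ G, g + b < 0) ∧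
      ∀ g ∈ G, ∃ x < 0, ∀ h ∈ G, x - h ∈ B → h = g := by
  obtain ⟨M, hMG, hM⟩ : ∃ M ∈ G, ∀ g ∈ G, g ≤ M := G.exists_max_image id hne
  have hM0 := hG M hMG
  let x : ℤ → ℤ := fun g => -1 - 2 * M - (2 * M + 1) * g
  have hx : ∀ g ∈ G, x g ≤ -1 - 2 * M := fun g hg => by
    have : 0 ≤ (2 * M + 1) * g := mul_nonneg (by omega) (hG g hg)
    simp only [x]
    omega
  have x_sep : ∀ g g', |x g - x g'| ≤ 2 * M → g = g' := fun g g' h => by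
    have h1 : x g - x g' = (2 * M + 1) * (g' - g) := by simp only [x]; ring
    rw [h1, abs_mul, abs_of_nonneg (by omega : (0 : ℤ) ≤ 2 * M + 1)] at h
    by_contra hgg
    have : 1 ≤ |g' - g| := Int.one_le_abs (by omega)
    nlinarith
  refine ⟨{b | b ≤ -1 - M ∧ ∀ g ∈ G, ∀ h ∈ G, h ≠ g → b ≠ x g - h}, ?_, ?_, ?_⟩
  · intro y hy
    by_contra! hcon
    have hole : ∀ g' ∈ G, y - g' ≤ -1 - M → ∃ g ∈ G, ∃ h ∈ G, h ≠ g ∧ y - g' = x g - h := by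
      intro g' hg' hle
      by_contra! hno
      exact hcon g' hg' ⟨hle, hno⟩
    obtain ⟨g, hg, h, hh, -, hyx⟩ := hole M hMG (by omega)
    have hsub : G.image (fun g' => x g - y + g') ⊆ G.erase g := by
      intro z hz
      obtain ⟨g', hg', rfl⟩ := Finset.mem_image.1 hz
      have := hx g hg
      have := hG g' hg'
      have := hM g' hg'
      have := hG h hh
      have := hM h hh
      obtain ⟨g₁, hg₁, h₁, hh₁, hne₁, hyx₁⟩ := hole g' hg' (by omega)
      have := hG h₁ hh₁
      have := hM h₁ hh₁
      obtain rfl : g = g₁ := x_sep g g₁ (abs_le.2 ⟨by omega, by omega⟩)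
      have : x g - y + g' = h₁ := by omega
      rw [this]
      exact Finset.mem_erase.2 ⟨hne₁, hh₁⟩
    have hcard := Finset.card_le_card hsub
    rw [Finset.card_image_of_injective _ (add_right_injective _)] at hcard
    exact absurd hcard (Finset.card_erase_lt_of_mem hg).not_ge
  · rintro b ⟨hb, -⟩ g hg
    have := hM g hg
    omega
  · intro g hg
    refine ⟨x g, by have := hx g hg; omega, fun h hh hb => ?_⟩
    by_contra hne
    exact hb.2 g hg h hh hne rfl

/-- Every set of the form `3ℕ ∪ F`, with `F` a finite nonempty subset of `3ℕ + 1`,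
arises as a minimal additive complement in `ℤ`. -/
theorem stmt19 (F : Set ℤ) (hFfin : F.Finite) (hFne : F.Nonempty)
    (hF : F ⊆ {z : ℤ | ∃ n : ℕ, z = 3 * n + 1}) :
    ∃ W : Set ℤ, MinAddComp ({z : ℤ | ∃ n : ℕ, z = 3 * n} ∪ F) W := by
  have hfin : {g : ℤ | 3 * g + 1 ∈ F}.Finite :=
    hFfin.preimage (f := fun g : ℤ => 3 * g + 1) fun a _ b _ h => by
      simp only at h
      omega
  have hmem : ∀ g, g ∈ hfin.toFinset ↔ 3 * g + 1 ∈ F := fun g => hfin.mem_toFinset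
  obtain ⟨f, hf⟩ := hFne
  obtain ⟨n₀, hn₀⟩ := hF hf
  obtain ⟨B, hcov, hneg, hmin⟩ := exists_neg_complement hfin.toFinset
    ⟨n₀, (hmem _).2 (hn₀ ▸ hf)⟩ fun g hg => by
      obtain ⟨n, hn⟩ := hF ((hmem g).1 hg)
      omega
  simp only [hmem] at hcov hneg hmin
  refine ⟨{w | (∃ b ∈ B, w = 3 * b) ∨ w = 1 ∨ ∃ k, w = 3 * k + 2}, ?_, ?_⟩
  · refine Set.eq_univ_of_forall fun z => Set.mem_add.2 ?_
    obtain ⟨q, rfl | rfl | rfl⟩ : ∃ q, z = 3 * q ∨ z = 3 * q + 1 ∨ z = 3 * q + 2 :=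
      ⟨z / 3, by omega⟩
    · exact ⟨f, .inr hf, 3 * q - f, .inr (.inr ⟨q - n₀ - 1, by omega⟩), by omega⟩
    · by_cases hq : 0 ≤ q
      · exact ⟨3 * q, .inl ⟨q.toNat, by omega⟩, 1, .inr (.inl rfl), rfl⟩
      · obtain ⟨g, hg, hb⟩ := hcov q (by omega)
        exact ⟨_, .inr hg, 3 * (q - g), .inl ⟨_, hb, rfl⟩, by omega⟩
    · exact ⟨0, .inl ⟨0, by simp⟩, 3 * q + 2, .inr (.inr ⟨q, rfl⟩), by omega⟩
  · intro C' hC' hC'W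
    obtain ⟨hsub, c, hc, hcC'⟩ := Set.ssubset_iff_exists.1 hC'
    have hrep : ∀ q : ℤ, 3 * q ∈ C' ∧ 0 ≤ q ∨ ∃ h, 3 * h + 1 ∈ C' ∧ 3 * h + 1 ∈ F ∧ q - h ∈ B := by
      intro q
      obtain ⟨c', hc', w, hw, hsum⟩ := Set.mem_add.1 (hC'W ▸ Set.mem_univ (3 * q + 1))
      have hcases : (∃ n : ℕ, c' = 3 * n) ∨ c' ∈ F ∧ ∃ n : ℕ, c' = 3 * n + 1 :=
        (hsub hc').imp id fun h => ⟨h, hF h⟩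
      rcases hw with ⟨b, hb, rfl⟩ | rfl | ⟨k, rfl⟩ <;>
        obtain ⟨n, rfl⟩ | ⟨hc'F, n, rfl⟩ := hcases
      · omega
      · obtain rfl : b = q - n := by omega
        exact .inr ⟨n, hc', hc'F, hb⟩
      · obtain rfl : q = n := by omega
        exact .inl ⟨hc', by omega⟩
      all_goals omega
    rcases hc with ⟨n, rfl⟩ | hcF
    · obtain ⟨h, -⟩ | ⟨h, -, hhF, hb⟩ := hrep n
      · exact hcC' h
      · have := hneg _ hb h hhF
        omega
    · obtain ⟨g, rfl⟩ := hF hcF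
      obtain ⟨x, hx, huniq⟩ := hmin g hcF
      obtain ⟨-, h⟩ | ⟨h, hhC', hhF, hb⟩ := hrep x
      · omega
      · obtain rfl := huniq h hhF hb
        exact hcC' hhC'
end
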